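/- arXiv:math/0307370 — 4 statements merged into one kernel-verified Lean document; each statement's English description precedes it below -/
import Mathlib

section
/- Let G be the graph of a pseudo-triangulation of a planar point set in general position. Then: (1) G is infinitesimally rigid (hence rigid and generically rigid in the plane); and (2) every subset of x non-pointed plus y pointed vertices of G, with x + y ≥ 2, spans a subgraph with at most 3x + 2y − 3 edges. -/
/-! ## Combinatorial plane graphs via rotation systems -/

/-- The permutation of darts of a simple graph reversing each dart. -/
def dartSymmPerm {V : Type} (G : SimpleGraph V) : Equiv.Perm G.Dart where
  toFun := SimpleGraph.Dart.symm
  invFun := SimpleGraph.Dart.symm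
  left_inv d := SimpleGraph.Dart.symm_symm d
  right_inv d := SimpleGraph.Dart.symm_symm d

/-- The setoid on `α` whose classes are the cycles (orbits) of a permutation `σ`. -/
def faceSetoid {α : Type} (σ : Equiv.Perm α) : Setoid α :=
  ⟨σ.SameCycle, ⟨fun x => Equiv.Perm.SameCycle.refl σ x,
    fun h => h.symm, fun h h' => h.trans h'⟩⟩

/-- A (topological, non-crossing) embedding of a connected graph `G` in the plane, encoded
combinatorially: a rotation system (the counterclockwise cyclic order of the darts around
each vertex), which is planar in the sense of Euler's formula (the number of orbits of the
face permutation `rot * symm` is the number of faces), together with a distinguished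
outer (unbounded) face.  A *plane graph* is a graph `G` together with such a structure. -/
structure PlaneEmb {V : Type} (G : SimpleGraph V) where
  rot : Equiv.Perm G.Dart
  rot_fst : ∀ d : G.Dart, (rot d).fst = d.fst
  rot_vertex : ∀ d d' : G.Dart, d.fst = d'.fst → ∃ n : ℕ, (rot ^ n) d = d'
  connected : G.Connected
  outer : Quotient (faceSetoid (rot * dartSymmPerm G))
  euler : Nat.card V + Nat.card (Quotient (faceSetoid (rot * dartSymmPerm G)))
      = Nat.card G.edgeSet + 2

namespace PlaneEmb

variable {V : Type} {G : SimpleGraph V}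

/-- The faces of a plane graph: orbits of the face permutation. -/
abbrev Face (E : PlaneEmb G) : Type := Quotient (faceSetoid (E.rot * dartSymmPerm G))

/-- The face having the dart `d` on its contour. -/
def dartFace (E : PlaneEmb G) (d : G.Dart) : E.Face :=
  Quotient.mk (faceSetoid (E.rot * dartSymmPerm G)) d

/-- Each dart `d` determines an *angle* of the plane graph, namely the angle at the vertex
`d.fst` between the edges of `d` and `rot d`; `E.angleFace d` is the face this angle lies in. -/
def angleFace (E : PlaneEmb G) (d : G.Dart) : E.Face :=
  Quotient.mk (faceSetoid (E.rot * dartSymmPerm G)) d.symm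

end PlaneEmb

/-- A vertex is *pointed* (w.r.t. an assignment `big` of which angles are labelled big)
if some angle at it is labelled big. -/
def PointedVx {V : Type} {G : SimpleGraph V} (big : G.Dart → Prop) (v : V) : Prop :=
  ∃ d : G.Dart, big d ∧ d.fst = v

/-- A *combinatorial pseudo-triangulation labelling* (CPT-labelling): every bounded face has
exactly three small angles, all angles of the unbounded face are big, and no vertex is
incident to more than one big angle. -/
structure IsCPTLabelling {V : Type} {G : SimpleGraph V} (E : PlaneEmb G)
    (big : G.Dart → Prop) : Prop where
  bounded_small : ∀ F : E.Face, F ≠ E.outer →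
    Nat.card {d : G.Dart | E.angleFace d = F ∧ ¬ big d} = 3
  outer_big : ∀ d : G.Dart, E.angleFace d = E.outer → big d
  one_big : ∀ d d' : G.Dart, big d → big d' → d.fst = d'.fst → d = d'

/-- The generalized Laman property of a combinatorial pseudo-triangulation: any `x` non-pointed
plus `y` pointed vertices, with `x + y ≥ 2`, induce at most `3x + 2y - 3` edges. -/
def GenLaman {V : Type} (G : SimpleGraph V) (big : G.Dart → Prop) : Prop :=
  ∀ S : Set V, 2 ≤ Nat.card S →
    (Nat.card ((G.induce S).edgeSet) : ℤ) ≤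
      3 * Nat.card {v ∈ S | ¬ PointedVx big v} + 2 * Nat.card {v ∈ S | PointedVx big v} - 3

/-! ## Rigidity -/

/-- Dot product in the plane. -/
def dot2 (u w : ℝ × ℝ) : ℝ := u.1 * w.1 + u.2 * w.2

/-- Rotation by 90 degrees. -/
def rot90 (u : ℝ × ℝ) : ℝ × ℝ := (-u.2, u.1)

/-- `q` is an infinitesimal motion of the bar-and-joint framework `(G, p)`. -/
def IsInfMotion {V : Type} (G : SimpleGraph V) (p q : V → ℝ × ℝ) : Prop :=
  ∀ u v : V, G.Adj u v → dot2 (p u - p v) (q u - q v) = 0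

/-- Trivial infinitesimal motions: those coming from rigid motions of the plane
(infinitesimal rotations and translations). -/
def IsTrivialMotion {V : Type} (p q : V → ℝ × ℝ) : Prop :=
  ∃ (a : ℝ) (t : ℝ × ℝ), ∀ v : V, q v = a • rot90 (p v) + t

/-- The framework `(G, p)` is infinitesimally rigid: it has no non-trivial infinitesimal
motions. -/
def InfRigid {V : Type} (G : SimpleGraph V) (p : V → ℝ × ℝ) : Prop :=
  ∀ q : V → ℝ × ℝ, IsInfMotion G p q → IsTrivialMotion p q

/-- A configuration of points is *generic* if its coordinates are algebraically
independent over `ℚ`. -/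
def GenericConf {V : Type} (p : V → ℝ × ℝ) : Prop :=
  AlgebraicIndependent ℚ (fun x : V ⊕ V => Sum.elim (fun v => (p v).1) (fun v => (p v).2) x)

/-- A graph is *generically rigid in the plane* if every generic framework on it has no
non-trivial infinitesimal motions. -/
def GenRigid {V : Type} (G : SimpleGraph V) : Prop :=
  ∀ p : V → ℝ × ℝ, GenericConf p → InfRigid G p

/-- A graph is *isostatic* (generically minimally rigid) if it is generically rigid and
removing any edge destroys generic rigidity. -/
def Isostatic {V : Type} (G : SimpleGraph V) : Prop :=
  GenRigid G ∧ ∀ e ∈ G.edgeSet, ¬ GenRigid (G.deleteEdges {e})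

/-- Laman's condition: exactly `2n - 3` edges, and every `k ≥ 2` vertices span at most
`2k - 3` edges. -/
def LamanGraph {V : Type} (L : SimpleGraph V) : Prop :=
  (Nat.card L.edgeSet : ℤ) = 2 * Nat.card V - 3 ∧
  ∀ S : Set V, 2 ≤ Nat.card S →
    (Nat.card ((L.induce S).edgeSet) : ℤ) ≤ 2 * Nat.card S - 3

/-! ## Geometry: straight-line drawings, angles, stretching -/

/-- The counterclockwise angle from the direction `u` to the direction `w`,
normalized to lie in `(0, 2π]` (a full turn for `w` pointing in the direction of `u`). -/
noncomputable def ccwAngle (u w : ℝ × ℝ) : ℝ :=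
  if 0 < Complex.arg ((⟨w.1, w.2⟩ : ℂ) / (⟨u.1, u.2⟩ : ℂ)) then
    Complex.arg ((⟨w.1, w.2⟩ : ℂ) / (⟨u.1, u.2⟩ : ℂ))
  else Complex.arg ((⟨w.1, w.2⟩ : ℂ) / (⟨u.1, u.2⟩ : ℂ)) + 2 * Real.pi

/-- The (counterclockwise) geometric angle, in the straight-line drawing `p`, of the angle of
the dart `d`, i.e. the angle at `d.fst` between the edge of `d` and the edge of `rot d`. -/
noncomputable def dartAngle {V : Type} {G : SimpleGraph V} (E : PlaneEmb G)
    (p : V → ℝ × ℝ) (d : G.Dart) : ℝ :=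
  ccwAngle (p d.snd - p d.fst) (p (E.rot d).snd - p (E.rot d).fst)

/-- A straight-line drawing is non-crossing: distinct edges meet only in common endpoints,
and no vertex lies on an edge not incident to it. -/
def NonCrossing {V : Type} (G : SimpleGraph V) (p : V → ℝ × ℝ) : Prop :=
  (∀ a b c d : V, G.Adj a b → G.Adj c d → ({a, b} : Set V) ≠ {c, d} →
    segment ℝ (p a) (p b) ∩ segment ℝ (p c) (p d) ⊆ p '' ({a, b} ∩ {c, d} : Set V)) ∧
  (∀ x a b : V, G.Adj a b → x ≠ a → x ≠ b → p x ∉ segment ℝ (p a) (p b))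

/-- The points of the drawing are in general position: no three of them are collinear. -/
def GenPos {V : Type} (p : V → ℝ × ℝ) : Prop :=
  ∀ u v w : V, u ≠ v → u ≠ w → v ≠ w → ¬ Collinear ℝ ({p u, p v, p w} : Set (ℝ × ℝ))

/-- The straight-line drawing `p` realizes the plane graph `(G, E)`: it is injective and
non-crossing, and around every (non-isolated) vertex the counterclockwise angles between
rotation-consecutive darts sum to `2π`, so the drawing induces the given rotation system. -/
def RealizesEmb {V : Type} [Fintype V] [DecidableEq V] (G : SimpleGraph V)
    [DecidableRel G.Adj] (E : PlaneEmb G) (p : V → ℝ × ℝ) : Prop :=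
  Function.Injective p ∧ NonCrossing G p ∧
  ∀ v : V, (∃ d : G.Dart, d.fst = v) →
    ∑ d ∈ Finset.univ.filter (fun d : G.Dart => d.fst = v), dartAngle E p d = 2 * Real.pi

/-- The drawing `p` *stretches* the angle labelling `big` of the plane graph `(G, E)`:
it realizes the embedding, has its (finitely many) vertices in general position, and every
angle labelled big is reflex (> 180°) while every angle labelled small is convex (< 180°).
If `big` is a CPT-labelling this makes `p` a pseudo-triangulation of its vertex set:
every bounded face is a pseudo-triangle and the convex hull edges are present. -/
def Stretches {V : Type} [Fintype V] [DecidableEq V] (G : SimpleGraph V)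
    [DecidableRel G.Adj] (E : PlaneEmb G) (big : G.Dart → Prop) (p : V → ℝ × ℝ) : Prop :=
  RealizesEmb G E p ∧ GenPos p ∧
  ∀ d : G.Dart, (big d → Real.pi < dartAngle E p d) ∧ (¬ big d → dartAngle E p d < Real.pi)

/-- The drawing `p` makes the plane graph `(G, E)` a pseudo-triangulation of its vertex set
(with the given embedding): for the labelling of the angles of the drawing as big (reflex)
or small (convex), every bounded face has exactly three small angles (is a pseudo-triangle)
and all outer angles are big (so the convex hull edges are present). -/
def StretchesToPT {V : Type} [Fintype V] [DecidableEq V] (G : SimpleGraph V)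
    [DecidableRel G.Adj] (E : PlaneEmb G) (p : V → ℝ × ℝ) : Prop :=
  ∃ big : G.Dart → Prop, IsCPTLabelling E big ∧ Stretches G E big p

/-- A vertex `v` of a geometric straight-line drawing is *pointed* if all the edges at `v`
lie in a closed half-plane supported at `v`. -/
def GeoPointed {V : Type} (G : SimpleGraph V) (p : V → ℝ × ℝ) (v : V) : Prop :=
  ∃ u : ℝ × ℝ, u ≠ 0 ∧ ∀ w : V, G.Adj v w → 0 ≤ dot2 u (p w - p v)

/-! ## Subgraphs, outer face, corners -/

/-- One step of dual connectivity avoiding the edge set `A`: the faces `F`, `F'` are the two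
sides of some edge of `G` not belonging to `A`. -/
def FaceStep {V : Type} {G : SimpleGraph V} (E : PlaneEmb G) (A : Set (Sym2 V)) :
    E.Face → E.Face → Prop :=
  fun F F' => ∃ d : G.Dart, E.dartFace d = F ∧ E.dartFace d.symm = F' ∧ d.edge ∉ A

/-- The face `F` of `G` is contained in the outer (unbounded) face of the plane subgraph of
`G` with edge set `A`: `F` can reach the outer face of `G` in the dual graph without
crossing the edges of `A`. -/
def InOuterOf {V : Type} {G : SimpleGraph V} (E : PlaneEmb G) (A : Set (Sym2 V))
    (F : E.Face) : Prop :=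
  Relation.ReflTransGen (FaceStep E A) F E.outer

/-- `v` is a *corner* of the subgraph `H` of the combinatorial pseudo-triangulation
`(G, E, big)`: either `v` is pointed in `G` and its big angle is contained in the
outer face of `H`, or `v` is non-pointed in `G` and two consecutive (small) angles at `v`
are contained in the outer face of `H`. -/
def IsCPTCorner {V : Type} {G : SimpleGraph V} (E : PlaneEmb G) (big : G.Dart → Prop)
    (H : G.Subgraph) (v : V) : Prop :=
  (v ∈ H.verts ∧ ∃ d : G.Dart, big d ∧ d.fst = v ∧ InOuterOf E H.edgeSet (E.angleFace d)) ∨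
  (v ∈ H.verts ∧ ¬ PointedVx big v ∧ ∃ d : G.Dart, d.fst = v ∧
    InOuterOf E H.edgeSet (E.angleFace d) ∧ InOuterOf E H.edgeSet (E.angleFace (E.rot d)) ∧
    (E.rot d).edge ∉ H.edgeSet)

/-- A plane graph has *non-degenerate faces* if no edge appears twice on the contour cycle of
a face, i.e. the edges incident to every face form a simple closed cycle. -/
def NonDegenerateFaces {V : Type} {G : SimpleGraph V} (E : PlaneEmb G) : Prop :=
  ∀ d : G.Dart, ¬ (E.rot * dartSymmPerm G).SameCycle d d.symm



noncomputable def cpx (u : ℝ × ℝ) : ℂ := ⟨u.1, u.2⟩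

theorem ccwAngle_pos (u w : ℝ × ℝ) : 0 < ccwAngle u w := by
  unfold ccwAngle
  split_ifs with h
  · exact h
  · have := Complex.neg_pi_lt_arg ((⟨w.1, w.2⟩ : ℂ) / (⟨u.1, u.2⟩ : ℂ))
    have := Real.pi_pos
    linarith

theorem ccwAngle_spec {u w : ℝ × ℝ} (hu : cpx u ≠ 0) (hw : cpx w ≠ 0) :
    ∃ ρ : ℝ, 0 < ρ ∧ cpx w = ρ * Complex.exp (ccwAngle u w * Complex.I) * cpx u := by
  have hz : cpx w / cpx u ≠ 0 := div_ne_zero hw hu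
  refine ⟨‖cpx w / cpx u‖, norm_pos_iff.mpr hz, ?_⟩
  have key : Complex.exp (ccwAngle u w * Complex.I)
      = Complex.exp (Complex.arg (cpx w / cpx u) * Complex.I) := by
    unfold ccwAngle
    split_ifs with h
    · rfl
    · push_cast
      rw [add_mul, Complex.exp_add, Complex.exp_two_pi_mul_I, mul_one]
      rfl
  rw [key, Complex.norm_mul_exp_arg_mul_I]
  field_simp

/-- polygon lemma -/
theorem polygon_lemma (z : ℕ → ℂ) (r θ : ℕ → ℝ) (k i₁ i₂ i₃ : ℕ)
    (hr : ∀ j, 0 < r j) (hz : ∀ j, z j = r j * Complex.exp (-(θ j * Complex.I)))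
    (h12 : i₁ < i₂) (h23 : i₂ < i₃) (h3 : i₃ + 1 < k)
    (hdec : ∀ j < k, j ≠ i₁ → j ≠ i₂ → j ≠ i₃ → θ (j + 1) ≤ θ j)
    (hlast : θ k < θ (k - 1))
    (hb₁ : θ (i₁ + 1) < θ i₁ + Real.pi) (hb₂ : θ (i₂ + 1) < θ i₂ + Real.pi)
    (hb₃ : θ (i₃ + 1) < θ i₃ + Real.pi)
    (htot : θ k = θ 0 + 2 * Real.pi)
    (hclosed : ∑ j ∈ Finset.range k, z j = 0)
    (a b : ℝ) (hab : a ≠ 0 ∨ b ≠ 0) :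
    ∃ j ≤ k, 0 < a * (∑ i ∈ Finset.range j, z i).re + b * (∑ i ∈ Finset.range j, z i).im := by
  have mono : ∀ m n : ℕ, n < k → (∀ j, m ≤ j → j < n → θ (j+1) ≤ θ j) →
      ∀ j, m ≤ j → j ≤ n → θ n ≤ θ j ∧ θ j ≤ θ m := by
    intro m n hn h
    have down : ∀ t, ∀ j, m ≤ j → j + t ≤ n → θ (j + t) ≤ θ j := by
      intro t
      induction t with
      | zero => intro j _ _; simp
      | succ t ih =>
        intro j hj hjt
        exact (h (j + t) (by omega) (by omega)).trans (ih j hj (by omega))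
    intro j hmj hjn
    constructor
    · have := down (n - j) j hmj (by omega)
      rwa [show j + (n - j) = n by omega] at this
    · have := down (j - m) m le_rfl (by omega)
      rwa [show m + (j - m) = j by omega] at this
  have m1 := mono 0 i₁ (by omega) (fun j _ _ => hdec j (by omega) (by omega) (by omega) (by omega))
  have m2 := mono (i₁+1) i₂ (by omega)
    (fun j _ _ => hdec j (by omega) (by omega) (by omega) (by omega))
  have m3 := mono (i₂+1) i₃ (by omega)
    (fun j _ _ => hdec j (by omega) (by omega) (by omega) (by omega))
  have m4 := mono (i₃+1) (k-1) (by omega)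
    (fun j _ _ => hdec j (by omega) (by omega) (by omega) (by omega))
  -- determinants of sums
  have hre : ∀ j, (z j).re = r j * Real.cos (θ j) := by
    intro j; rw [hz, ← neg_mul, ← Complex.ofReal_neg, Complex.re_ofReal_mul,
      Complex.exp_ofReal_mul_I_re, Real.cos_neg]
  have him : ∀ j, (z j).im = - (r j * Real.sin (θ j)) := by
    intro j; rw [hz, ← neg_mul, ← Complex.ofReal_neg, Complex.im_ofReal_mul,
      Complex.exp_ofReal_mul_I_im, Real.sin_neg]; ring
  have det : ∀ s t : Finset ℕ, s.Nonempty → t.Nonempty →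
      (∀ i ∈ s, ∀ j ∈ t, 0 < Real.sin (θ j - θ i)) →
      (∑ i ∈ s, z i).re * (∑ i ∈ t, z i).im - (∑ i ∈ s, z i).im * (∑ i ∈ t, z i).re < 0 := by
    intro s t hs ht h
    have e : (∑ i ∈ s, z i).re * (∑ i ∈ t, z i).im - (∑ i ∈ s, z i).im * (∑ i ∈ t, z i).re
        = - ∑ i ∈ s, ∑ j ∈ t, r i * r j * Real.sin (θ j - θ i) := by
      simp only [Complex.re_sum, Complex.im_sum]
      rw [Finset.sum_mul_sum, Finset.sum_mul_sum, ← Finset.sum_sub_distrib,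
        ← Finset.sum_neg_distrib]
      refine Finset.sum_congr rfl fun i _ => ?_
      rw [← Finset.sum_sub_distrib, ← Finset.sum_neg_distrib]
      refine Finset.sum_congr rfl fun j _ => ?_
      rw [hre, hre, him, him, Real.sin_sub]; ring
    rw [e, neg_lt_zero]
    exact Finset.sum_pos (fun i hi => Finset.sum_pos
      (fun j hj => mul_pos (mul_pos (hr i) (hr j)) (h i hi j hj)) ht) hs
  have pi := Real.pi_pos
  have b1 := m1 i₁ (by omega) le_rfl
  have b2 := m2 i₂ (by omega) le_rfl
  have b3 := m3 i₃ (by omega) le_rfl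
  have b4 := m4 (k-1) (by omega) le_rfl
  have d12 := det (Finset.Ico 0 (i₁+1)) (Finset.Ico (i₁+1) (i₂+1)) (by simp) (by simp; omega) (by
    intro i hi j hj
    rw [Finset.mem_Ico] at hi hj
    have := m1 i (by omega) (by omega)
    have := m2 j (by omega) (by omega)
    apply Real.sin_pos_of_pos_of_lt_pi <;> linarith)
  have d34 := det (Finset.Ico (i₂+1) (i₃+1)) (Finset.Ico (i₃+1) k) (by simp; omega)
    (by simp; omega) (by
    intro i hi j hj
    rw [Finset.mem_Ico] at hi hj
    have := m3 i (by omega) (by omega)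
    have := m4 j (by omega) (by omega)
    apply Real.sin_pos_of_pos_of_lt_pi <;> linarith)
  have d14 := det (Finset.Ico 0 (i₁+1)) (Finset.Ico (i₃+1) k) (by simp)
    (by simp; omega) (by
    intro i hi j hj
    rw [Finset.mem_Ico] at hi hj
    have := m1 i (by omega) (by omega)
    have := m4 j (by omega) (by omega)
    rw [← Real.sin_sub_two_pi]
    apply Real.sin_pos_of_pos_of_lt_pi <;> linarith)
  have s2 := Finset.sum_Ico_consecutive z (Nat.zero_le (i₁+1)) (show i₁+1 ≤ i₂+1 by omega)
  have s3 := Finset.sum_Ico_consecutive z (Nat.zero_le (i₂+1)) (show i₂+1 ≤ i₃+1 by omega)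
  have s4 := Finset.sum_Ico_consecutive z (Nat.zero_le (i₃+1)) (show i₃+1 ≤ k by omega)
  simp only [Nat.Ico_zero_eq_range] at s2 s3 s4 d12 d34 d14
  rw [hclosed] at s4
  by_contra hcon
  push Not at hcon
  have g1 := hcon (i₁+1) (by omega)
  have g2 := hcon (i₂+1) (by omega)
  have g3 := hcon (i₃+1) (by omega)
  rw [← s2] at s3 g2
  rw [← s3] at s4 g3
  generalize (∑ i ∈ Finset.range (i₁+1), z i) = c1 at *
  generalize (∑ i ∈ Finset.Ico (i₁+1) (i₂+1), z i) = c2 at *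
  generalize (∑ i ∈ Finset.Ico (i₂+1) (i₃+1), z i) = c3 at *
  generalize (∑ i ∈ Finset.Ico (i₃+1) k, z i) = c4 at *
  have e1 := congrArg Complex.re s4
  have e2 := congrArg Complex.im s4
  simp only [Complex.add_re, Complex.add_im, Complex.zero_re, Complex.zero_im] at e1 e2 g1 g2 g3
  have f1 : c4.re = -(c1.re+c2.re+c3.re) := by linarith
  have f2 : c4.im = -(c1.im+c2.im+c3.im) := by linarith
  rw [f1, f2] at d34 d14
  set A := c1.re * c2.im - c1.im * c2.re with hA
  set B := c3.re * -(c1.im + c2.im + c3.im) - c3.im * -(c1.re + c2.re + c3.re) with hB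
  set C := c1.re * -(c1.im + c2.im + c3.im) - c1.im * -(c1.re + c2.re + c3.re) with hC
  have id : B * (a * c1.re + b * c1.im) + C * (a * (c1.re + c2.re) + b * (c1.im + c2.im))
      + A * (a * (c1.re + c2.re + c3.re) + b * (c1.im + c2.im + c3.im)) = 0 := by
    rw [hA, hB, hC]; ring
  have t1 := mul_nonneg_of_nonpos_of_nonpos d34.le g1
  have t2 := mul_nonneg_of_nonpos_of_nonpos d14.le g2
  have t3 := mul_nonneg_of_nonpos_of_nonpos d12.le g3
  have z1 : a * c1.re + b * c1.im = 0 := by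
    have : B * (a * c1.re + b * c1.im) = 0 := by linarith
    exact (mul_eq_zero.mp this).resolve_left d34.ne
  have z2 : a * (c1.re + c2.re) + b * (c1.im + c2.im) = 0 := by
    have : C * (a * (c1.re + c2.re) + b * (c1.im + c2.im)) = 0 := by linarith
    exact (mul_eq_zero.mp this).resolve_left d14.ne
  have za : a * A = 0 := by rw [hA]; linear_combination (c1.im + c2.im) * z1 - c1.im * z2
  have zb : b * A = 0 := by rw [hA]; linear_combination -(c1.re + c2.re) * z1 + c1.re * z2
  rcases hab with h | h
  · exact h ((mul_eq_zero.mp za).resolve_right d12.ne)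
  · exact h ((mul_eq_zero.mp zb).resolve_right d12.ne)


section PTpart
set_option linter.unusedSectionVars false
variable {V : Type} [Fintype V] [DecidableEq V] {G : SimpleGraph V} [DecidableRel G.Adj]

noncomputable def dz (p : V → ℝ × ℝ) (d : G.Dart) : ℂ := cpx (p d.snd - p d.fst)

abbrev phi (E : PlaneEmb G) : Equiv.Perm G.Dart := E.rot * dartSymmPerm G

noncomputable def turn (E : PlaneEmb G) (p : V → ℝ × ℝ) (d : G.Dart) : ℝ :=
  Real.pi - dartAngle E p d.symm

theorem phi_apply (E : PlaneEmb G) (d : G.Dart) : phi E d = E.rot d.symm := rfl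

theorem dartFace_phi (E : PlaneEmb G) (d : G.Dart) : E.dartFace (phi E d) = E.dartFace d :=
  Quotient.sound (s := faceSetoid (phi E))
    (show (phi E).SameCycle (phi E d) d from ⟨-1, by simp⟩)

theorem dartFace_rot (E : PlaneEmb G) (d : G.Dart) :
    E.dartFace (E.rot d) = E.dartFace d.symm := by
  have := dartFace_phi E d.symm
  rwa [phi_apply, SimpleGraph.Dart.symm_symm] at this

theorem dz_ne_zero {p : V → ℝ × ℝ} (hp : Function.Injective p) (d : G.Dart) : dz p d ≠ 0 := by
  intro h
  have h1 := congrArg Complex.re h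
  have h2 := congrArg Complex.im h
  simp [dz, cpx] at h1 h2
  exact d.adj.ne (hp (Prod.ext (by linarith) (by linarith)))

theorem dz_symm (p : V → ℝ × ℝ) (d : G.Dart) : dz p d.symm = - dz p d := by
  apply Complex.ext <;> simp [dz, cpx]

theorem rot_spec (E : PlaneEmb G) {p : V → ℝ × ℝ} (hp : Function.Injective p) (d : G.Dart) :
    ∃ ρ : ℝ, 0 < ρ ∧
      dz p (E.rot d) = ρ * Complex.exp (dartAngle E p d * Complex.I) * dz p d :=
  ccwAngle_spec (dz_ne_zero hp d) (dz_ne_zero hp (E.rot d))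

theorem dartAngle_pos (E : PlaneEmb G) (p : V → ℝ × ℝ) (d : G.Dart) : 0 < dartAngle E p d :=
  ccwAngle_pos _ _

theorem turn_spec (E : PlaneEmb G) {p : V → ℝ × ℝ} (hp : Function.Injective p) (d : G.Dart) :
    ∃ ρ : ℝ, 0 < ρ ∧
      dz p (phi E d) = ρ * Complex.exp (-(turn E p d * Complex.I)) * dz p d := by
  obtain ⟨ρ, h, e⟩ := rot_spec E hp d.symm
  refine ⟨ρ, h, ?_⟩
  rw [phi_apply, e, dz_symm]
  have : Complex.exp (-(turn E p d * Complex.I))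
      = - Complex.exp (dartAngle E p d.symm * Complex.I) := by
    unfold turn
    push_cast
    rw [show -(((Real.pi : ℂ) - dartAngle E p d.symm) * Complex.I)
      = dartAngle E p d.symm * Complex.I - Real.pi * Complex.I by ring, Complex.exp_sub,
      Complex.exp_pi_mul_I, div_neg, div_one]
  rw [this]; ring

open Classical in
theorem face_sum_int (E : PlaneEmb G) {p : V → ℝ × ℝ} (hp : Function.Injective p) (F : E.Face) :
    ∃ t : ℤ, ∑ d ∈ Finset.univ.filter (fun d => E.dartFace d = F), turn E p d
      = 2 * Real.pi * t := by
  set s := Finset.univ.filter (fun d => E.dartFace d = F) with hs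
  choose ρ hρ e using turn_spec E hp
  have h1 : ∏ d ∈ s, dz p (phi E d) = ∏ d ∈ s, dz p d := by
    apply Finset.prod_equiv (phi E)
    · intro d; rw [hs, Finset.mem_filter, Finset.mem_filter, dartFace_phi]; simp
    · intros; rfl
  have h2 : ∏ d ∈ s, dz p d ≠ 0 := Finset.prod_ne_zero_iff.mpr fun d _ => dz_ne_zero hp d
  have h3 : ((∏ d ∈ s, ρ d : ℝ) : ℂ)
      * Complex.exp (-((∑ d ∈ s, turn E p d : ℝ) * Complex.I)) = 1 := by
    apply mul_right_cancel₀ h2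
    rw [one_mul]
    conv_rhs => rw [← h1]
    rw [Finset.prod_congr rfl fun d _ => e d, Finset.prod_mul_distrib, Finset.prod_mul_distrib,
      ← Complex.exp_sum]
    push_cast
    rw [Finset.sum_mul, Finset.sum_neg_distrib]
  have hpos : 0 < ∏ d ∈ s, ρ d := Finset.prod_pos fun d _ => hρ d
  have h4 : ∏ d ∈ s, ρ d = 1 := by
    have := congrArg norm h3
    rw [norm_mul, ← neg_mul, ← Complex.ofReal_neg, Complex.norm_exp_ofReal_mul_I, mul_one,
      norm_one, Complex.norm_real, Real.norm_of_nonneg hpos.le] at this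
    exact this
  rw [h4, Complex.ofReal_one, one_mul, Complex.exp_eq_one_iff] at h3
  obtain ⟨n, hn⟩ := h3
  refine ⟨-n, ?_⟩
  have := congrArg Complex.im hn
  simp at this
  push_cast
  linarith

theorem exists_dart (E : PlaneEmb G) (v : V) : ∃ d : G.Dart, d.fst = v := by
  obtain ⟨d0, -⟩ := Quotient.exists_rep E.outer
  have hnt : Nontrivial V := ⟨⟨d0.fst, d0.snd, d0.adj.ne⟩⟩
  obtain ⟨w, hw⟩ := E.connected.preconnected.exists_adj_of_nontrivial v
  exact ⟨⟨(v, w), hw⟩, rfl⟩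

theorem card_darts : Fintype.card G.Dart = 2 * Nat.card G.edgeSet := by
  rw [G.dart_card_eq_twice_card_edges, Nat.card_eq_fintype_card, SimpleGraph.edgeFinset_card]

theorem turn_total (E : PlaneEmb G) {p : V → ℝ × ℝ} (h : RealizesEmb G E p) :
    ∑ d : G.Dart, turn E p d
      = 2 * Real.pi * ((Nat.card G.edgeSet : ℝ) - Nat.card V) := by
  unfold turn
  rw [Finset.sum_sub_distrib]
  have h1 : ∑ d : G.Dart, dartAngle E p d.symm = ∑ d : G.Dart, dartAngle E p d :=
    Equiv.sum_comp (dartSymmPerm G) (fun d => dartAngle E p d)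
  have h2 : ∑ d : G.Dart, dartAngle E p d = ∑ v : V, 2 * Real.pi := by
    rw [← Finset.sum_fiberwise (s := Finset.univ) (g := fun d : G.Dart => d.fst)]
    exact Finset.sum_congr rfl fun v _ => h.2.2 v (exists_dart E v)
  rw [h1, h2]
  simp [card_darts]
  ring

variable {E : PlaneEmb G} {big : G.Dart → Prop} {p : V → ℝ × ℝ}

theorem turn_small (hs : Stretches G E big p) (d : G.Dart) (h : ¬ big d.symm) :
    0 < turn E p d ∧ turn E p d < Real.pi := by
  have := (hs.2.2 d.symm).2 h
  have := dartAngle_pos E p d.symm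
  unfold turn
  constructor <;> linarith

theorem turn_big (hs : Stretches G E big p) (d : G.Dart) (h : big d.symm) :
    turn E p d < 0 := by
  have := (hs.2.2 d.symm).1 h
  unfold turn
  linarith

open Classical in
theorem card_small (hc : IsCPTLabelling E big) (F : E.Face) (hF : F ≠ E.outer) :
    (Finset.univ.filter (fun d : G.Dart => E.dartFace d = F ∧ ¬ big d.symm)).card = 3 := by
  rw [← hc.bounded_small F hF]
  rw [Nat.card_eq_fintype_card, Fintype.card_subtype]
  apply Finset.card_equiv (dartSymmPerm G)
  intro d
  simp only [Finset.mem_filter, Finset.mem_univ, true_and]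
  change _ ↔ E.dartFace d.symm.symm = F ∧ ¬ big d.symm
  rw [SimpleGraph.Dart.symm_symm]

open Classical in
theorem face_sum (hc : IsCPTLabelling E big) (hs : Stretches G E big p) (F : E.Face)
    (hF : F ≠ E.outer) :
    ∑ d ∈ Finset.univ.filter (fun d => E.dartFace d = F), turn E p d = 2 * Real.pi := by
  have : Fintype E.Face := Fintype.ofFinite _
  choose t ht using face_sum_int E hs.1.1
  have pi := Real.pi_pos
  have hle : ∀ F, F ≠ E.outer → t F ≤ 1 := by
    intro F hF
    have h1 : ∑ d ∈ Finset.univ.filter (fun d => E.dartFace d = F), turn E p d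
        ≤ ∑ d ∈ Finset.univ.filter (fun d => E.dartFace d = F),
          (if ¬ big d.symm then Real.pi else 0) := by
      apply Finset.sum_le_sum
      intro d _
      split_ifs with h
      · exact (turn_big hs d h).le
      · exact (turn_small hs d h).2.le
    rw [← Finset.sum_filter, Finset.filter_filter, Finset.sum_const, card_small hc F hF, ht] at h1
    have h2 : (t F : ℝ) < 2 := by
      by_contra hcon
      push Not at hcon
      simp at h1
      nlinarith
    have : t F < 2 := by exact_mod_cast h2
    omega
  have hout : t E.outer ≤ -1 := by
    have h1 : ∑ d ∈ Finset.univ.filter (fun d => E.dartFace d = E.outer), turn E p d < 0 := by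
      apply Finset.sum_neg
      · intro d hd
        apply turn_big hs
        apply hc.outer_big
        simp at hd
        change E.dartFace d.symm.symm = _
        rwa [SimpleGraph.Dart.symm_symm]
      · obtain ⟨d0, h0⟩ := Quotient.exists_rep E.outer
        exact ⟨d0, by rw [Finset.mem_filter]; exact ⟨Finset.mem_univ _, h0⟩⟩
    rw [ht] at h1
    have h2 : (t E.outer : ℝ) < 0 := by
      by_contra hcon
      push Not at hcon
      nlinarith
    have : t E.outer < 0 := by exact_mod_cast h2
    omega
  have htot : ∑ F, t F = (Nat.card E.Face : ℤ) - 2 := by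
    have h1 := turn_total E hs.1
    rw [← Finset.sum_fiberwise (s := Finset.univ) (g := fun d : G.Dart => E.dartFace d)] at h1
    rw [Finset.sum_congr rfl fun F _ => ht F, ← Finset.mul_sum] at h1
    have h2 := mul_left_cancel₀ (by positivity) h1
    have h3 := E.euler
    have h4 : ∑ F, t F = (Nat.card G.edgeSet : ℤ) - Nat.card V := by exact_mod_cast h2
    rw [h4]
    change Nat.card V + Nat.card E.Face = _ at h3
    omega
  have hF1 : t F = 1 := by
    by_contra hne
    have hlt : t F ≤ 0 := by have := hle F hF; omega
    have h1 : ∑ F', t F' ≤ ∑ F' : E.Face,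
        ((1 : ℤ) - (if F' = E.outer then 2 else 0) - (if F' = F then 1 else 0)) := by
      apply Finset.sum_le_sum
      intro F' _
      by_cases h1 : F' = E.outer
      · subst h1; rw [if_pos rfl, if_neg (Ne.symm hF)]; omega
      · rw [if_neg h1]
        split_ifs with h2
        · subst h2; omega
        · have := hle F' h1; omega
    rw [htot] at h1
    simp [Finset.sum_sub_distrib] at h1
  rw [ht, hF1]; simp

end PTpart


section PTpart
set_option linter.unusedSectionVars false
variable {V : Type} [Fintype V] [DecidableEq V] {G : SimpleGraph V} [DecidableRel G.Adj]
variable {E : PlaneEmb G} {big : G.Dart → Prop} {p : V → ℝ × ℝ}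

theorem arg_step (z : ℂ) (hz : z ≠ 0) (h0 : 0 ≤ z.im) (ρ α : ℝ) (hρ : 0 < ρ) (hα : 0 < α)
    (hα' : α < Real.pi) (h1 : 0 ≤ (ρ * Complex.exp (α * Complex.I) * z).im) :
    z.arg < (ρ * Complex.exp (α * Complex.I) * z).arg := by
  have ha := Complex.arg_nonneg_iff.mpr h0
  have ha' := Complex.arg_le_pi z
  have hn : 0 < ‖z‖ := norm_pos_iff.mpr hz
  have e : ρ * Complex.exp (α * Complex.I) * z
      = ((ρ * ‖z‖ : ℝ) : ℂ) * Complex.exp ((α + z.arg : ℝ) * Complex.I) := by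
    conv_lhs => rw [← Complex.norm_mul_exp_arg_mul_I z]
    push_cast
    rw [add_mul, Complex.exp_add]; ring
  rw [e] at h1 ⊢
  have hpos : 0 < ρ * ‖z‖ := mul_pos hρ hn
  by_cases hle : α + z.arg ≤ Real.pi
  · rw [Complex.arg_real_mul _ hpos, Complex.exp_mul_I, Complex.arg_cos_add_sin_mul_I
      ⟨by linarith, hle⟩]
    linarith
  · exfalso
    push Not at hle
    rw [Complex.im_ofReal_mul, Complex.exp_ofReal_mul_I_im] at h1
    have : 0 < Real.sin (α + z.arg - Real.pi) :=
      Real.sin_pos_of_pos_of_lt_pi (by linarith) (by linarith)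
    rw [Real.sin_sub_pi] at this
    nlinarith

theorem nonpointed_surround (hs : Stretches G E big p) (v : V)
    (hv : ¬ PointedVx big v) (a b : ℝ) (hab : a ≠ 0 ∨ b ≠ 0) :
    ∃ d : G.Dart, d.fst = v ∧ 0 < a * (dz p d).re + b * (dz p d).im := by
  by_contra hcon
  push Not at hcon
  obtain ⟨d0, hd0⟩ := exists_dart E v
  set c : ℂ := ⟨-b, -a⟩ with hc
  have hc0 : c ≠ 0 := by
    intro h
    have h1 := congrArg Complex.re h
    have h2 := congrArg Complex.im h
    simp [hc] at h1 h2
    tauto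
  have him : ∀ d : G.Dart, d.fst = v → 0 ≤ (c * dz p d).im := by
    intro d hd
    have := hcon d hd
    rw [Complex.mul_im, hc]
    dsimp only
    linarith
  obtain ⟨d, hd, hmax⟩ := Finset.exists_max_image
    (Finset.univ.filter (fun d : G.Dart => d.fst = v)) (fun d => (c * dz p d).arg)
    ⟨d0, by simpa using hd0⟩
  simp only [Finset.mem_filter, Finset.mem_univ, true_and] at hd hmax
  have hr : (E.rot d).fst = v := by rw [E.rot_fst, hd]
  have h1 := hmax _ hr
  obtain ⟨ρ, hρ, e⟩ := rot_spec E hs.1.1 d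
  have hsm : ¬ big d := fun h => hv ⟨d, h, hd⟩
  have h2 := him _ hr
  have e2 : c * dz p (E.rot d)
      = ρ * Complex.exp (dartAngle E p d * Complex.I) * (c * dz p d) := by rw [e]; ring
  rw [e2] at h1 h2
  have := arg_step (c * dz p d) (mul_ne_zero hc0 (dz_ne_zero hs.1.1 d)) (him d hd) ρ _ hρ
    (dartAngle_pos E p d) ((hs.2.2 d).2 hsm) h2
  linarith

theorem small_det (hs : Stretches G E big p) (d : G.Dart) (h : ¬ big d) :
    (dz p d).re * (dz p (E.rot d)).im - (dz p d).im * (dz p (E.rot d)).re ≠ 0 := by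
  obtain ⟨ρ, hρ, e⟩ := rot_spec E hs.1.1 d
  have h0 := dz_ne_zero hs.1.1 d
  have hsin := Real.sin_pos_of_pos_of_lt_pi (dartAngle_pos E p d) ((hs.2.2 d).2 h)
  have hn : 0 < Complex.normSq (dz p d) := Complex.normSq_pos.mpr h0
  have : (dz p d).re * (dz p (E.rot d)).im - (dz p d).im * (dz p (E.rot d)).re
      = ρ * Real.sin (dartAngle E p d) * Complex.normSq (dz p d) := by
    rw [e]
    simp only [Complex.mul_im, Complex.mul_re, Complex.ofReal_re, Complex.ofReal_im,
      Complex.exp_ofReal_mul_I_re, Complex.exp_ofReal_mul_I_im, Complex.normSq_apply]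
    ring
  rw [this]
  positivity

open Classical in
theorem big_surround (hc : IsCPTLabelling E big) (hs : Stretches G E big p) (d : G.Dart)
    (hd : big d) (hF : E.angleFace d ≠ E.outer) (a b : ℝ) (hab : a ≠ 0 ∨ b ≠ 0) :
    ∃ e : G.Dart, E.dartFace e = E.angleFace d ∧
      0 < a * ((p e.fst).1 - (p d.fst).1) + b * ((p e.fst).2 - (p d.fst).2) := by
  set δ : ℕ → G.Dart := fun j => (phi E)^[j] (E.rot d) with hδ
  have hδs : ∀ j, δ (j+1) = phi E (δ j) := fun j => Function.iterate_succ_apply' _ _ _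
  have hface : ∀ j, E.dartFace (δ j) = E.angleFace d := by
    intro j
    induction j with
    | zero => exact dartFace_rot E d
    | succ j ih => rw [hδs, dartFace_phi, ih]
  set k := Function.minimalPeriod (phi E) (E.rot d) with hk
  have hper : E.rot d ∈ Function.periodicPts (phi E) :=
    (phi E).injective.mem_periodicPts _
  have hkpos : 0 < k := Function.minimalPeriod_pos_of_mem_periodicPts hper
  have hδk : δ k = δ 0 := Function.iterate_minimalPeriod
  have hinj : Set.InjOn δ (Finset.range k : Set ℕ) := by
    rw [Finset.coe_range]
    exact Function.iterate_injOn_Iio_minimalPeriod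
  have himg : Finset.univ.filter (fun e => E.dartFace e = E.angleFace d)
      = (Finset.range k).image δ := by
    ext e
    simp only [Finset.mem_filter, Finset.mem_univ, true_and, Finset.mem_image, Finset.mem_range]
    constructor
    · intro he
      have h1 : (phi E).SameCycle (E.rot d) e := by
        have : E.dartFace (E.rot d) = E.dartFace e := by rw [he]; exact dartFace_rot E d
        exact Quotient.exact (s := faceSetoid (phi E)) this
      obtain ⟨i, hi⟩ := h1.exists_nat_pow_eq
      refine ⟨i % k, Nat.mod_lt _ hkpos, ?_⟩
      rw [← hi, Equiv.Perm.coe_pow]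
      exact Function.iterate_mod_minimalPeriod_eq
    · rintro ⟨j, -, rfl⟩
      exact hface j
  have hlastd : (δ (k-1)).symm = d := by
    have h1 := hδs (k-1)
    rw [Nat.sub_add_cancel hkpos, hδk] at h1
    exact (E.rot.injective h1).symm
  have hsum : ∑ j ∈ Finset.range k, turn E p (δ j) = 2 * Real.pi := by
    rw [← face_sum hc hs _ hF, himg, Finset.sum_image hinj]
  set T := (Finset.range k).filter (fun j => ¬ big (δ j).symm) with hT
  have hcard : T.card = 3 := by
    rw [← card_small hc _ hF, ← Finset.filter_filter, himg, Finset.filter_image,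
      Finset.card_image_of_injOn (hinj.mono (Finset.coe_subset.mpr (Finset.filter_subset _ _)))]
  set θ : ℕ → ℝ := fun j => -(dz p (δ 0)).arg + ∑ i ∈ Finset.range j, turn E p (δ i) with hθ
  have hθs : ∀ j, θ (j+1) = θ j + turn E p (δ j) := by
    intro j; simp only [hθ]; rw [Finset.sum_range_succ]; ring
  have hz : ∀ j, ∃ r : ℝ, 0 < r ∧ dz p (δ j) = r * Complex.exp (-(θ j * Complex.I)) := by
    intro j
    induction j with
    | zero =>
      refine ⟨‖dz p (δ 0)‖, norm_pos_iff.mpr (dz_ne_zero hs.1.1 _), ?_⟩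
      simp [hθ]
    | succ j ih =>
      obtain ⟨r, hr, e⟩ := ih
      obtain ⟨ρ, hρ, e'⟩ := turn_spec E hs.1.1 (δ j)
      refine ⟨ρ * r, mul_pos hρ hr, ?_⟩
      rw [hδs, e', e, hθs]
      push_cast
      rw [show -(((θ j : ℂ) + turn E p (δ j)) * Complex.I)
        = -(turn E p (δ j) * Complex.I) + -(θ j * Complex.I) by ring, Complex.exp_add]
      ring
  choose r hr hzr using hz
  have hpart : ∀ j, ∑ i ∈ Finset.range j, dz p (δ i) = cpx (p (δ j).fst - p d.fst) := by
    intro j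
    induction j with
    | zero =>
      have : (δ 0).fst = d.fst := E.rot_fst d
      rw [this]; apply Complex.ext <;> simp [cpx]
    | succ j ih =>
      have : (δ (j+1)).fst = (δ j).snd := by rw [hδs]; exact E.rot_fst _
      rw [Finset.sum_range_succ, ih, this]
      apply Complex.ext <;> simp [cpx, dz]
  set f := T.orderEmbOfFin hcard with hf
  have hfm : ∀ i, f i ∈ T := fun i => Finset.orderEmbOfFin_mem T hcard i
  have hrange : ∀ j ∈ T, ∃ i, f i = j := by
    intro j hj
    have : j ∈ Set.range f := by rw [hf, Finset.range_orderEmbOfFin]; exact hj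
    exact this
  have hfm' : ∀ i, f i < k ∧ ¬ big (δ (f i)).symm := fun i => by simpa [hT] using hfm i
  have hcl : ∑ i ∈ Finset.range k, dz p (δ i) = 0 := by
    have : (δ 0).fst = d.fst := E.rot_fst d
    rw [hpart, hδk, this]; apply Complex.ext <;> simp [cpx]
  obtain ⟨j, -, hj⟩ := polygon_lemma (fun j => dz p (δ j)) r θ k (f 0) (f 1) (f 2) hr hzr
    (f.strictMono (by decide)) (f.strictMono (by decide))
    (by
      have h1 := hfm' 2
      have : f 2 ≠ k - 1 := by
        intro h
        rw [h, hlastd] at h1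
        exact h1.2 hd
      omega)
    (by
      intro j hj h0 h1 h2
      rw [hθs]
      have : big (δ j).symm := by
        by_contra hb
        obtain ⟨i, hi⟩ := hrange j (by simp [hT, hj, hb])
        fin_cases i
        · exact h0 hi.symm
        · exact h1 hi.symm
        · exact h2 hi.symm
      have := turn_big hs (δ j) this
      linarith)
    (by
      have h1 := hθs (k-1)
      rw [Nat.sub_add_cancel hkpos] at h1
      have := turn_big hs (δ (k-1)) (by rw [hlastd]; exact hd)
      linarith)
    (by rw [hθs]; have := (turn_small hs _ (hfm' 0).2).2; linarith)
    (by rw [hθs]; have := (turn_small hs _ (hfm' 1).2).2; linarith)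
    (by rw [hθs]; have := (turn_small hs _ (hfm' 2).2).2; linarith)
    (by simp only [hθ]; rw [hsum]; simp)
    hcl a b hab
  refine ⟨δ j, hface j, ?_⟩
  rw [hpart] at hj
  simpa [cpx] using hj

end PTpart


section PTpart
set_option linter.unusedSectionVars false
variable {V : Type} [Fintype V] [DecidableEq V] {G : SimpleGraph V} [DecidableRel G.Adj]
variable {E : PlaneEmb G} {big : G.Dart → Prop} {p : V → ℝ × ℝ}

theorem orth_closed (h : V → ℝ) (c : G.Dart → ℝ) (ha : ∀ d, c d.symm = - c d)
    (hc : ∀ v, ∑ d ∈ Finset.univ.filter (fun d : G.Dart => d.fst = v), c d = 0) :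
    ∑ d : G.Dart, (h d.snd - h d.fst) * c d = 0 := by
  have h1 : ∑ d : G.Dart, h d.fst * c d = 0 := by
    rw [← Finset.sum_fiberwise (s := Finset.univ) (g := fun d : G.Dart => d.fst)]
    apply Finset.sum_eq_zero
    intro v _
    have : ∑ d ∈ Finset.univ.filter (fun d : G.Dart => d.fst = v), h d.fst * c d
        = ∑ d ∈ Finset.univ.filter (fun d : G.Dart => d.fst = v), h v * c d := by
      apply Finset.sum_congr rfl
      intro d hd
      rw [(Finset.mem_filter.mp hd).2]
    rw [this, ← Finset.mul_sum, hc, mul_zero]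
  have h2 : ∑ d : G.Dart, h d.snd * c d = 0 := by
    rw [← Equiv.sum_comp (dartSymmPerm G)]
    have : ∀ d : G.Dart, h (dartSymmPerm G d).snd * c (dartSymmPerm G d) = -(h d.fst * c d) := by
      intro d
      change h d.symm.snd * c d.symm = _
      rw [ha]
      change h d.fst * _ = _
      ring
    rw [Finset.sum_congr rfl fun d _ => this d, Finset.sum_neg_distrib, h1, neg_zero]
  simp only [sub_mul, Finset.sum_sub_distrib, h1, h2, sub_zero]

theorem closed_face (ρ : E.Face → ℝ) (v : V) :
    ∑ d ∈ Finset.univ.filter (fun d : G.Dart => d.fst = v),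
      (ρ (E.dartFace d) - ρ (E.dartFace d.symm)) = 0 := by
  rw [Finset.sum_sub_distrib, sub_eq_zero]
  symm
  apply Finset.sum_equiv E.rot
  · intro d; simp [E.rot_fst]
  · intro d _; rw [dartFace_rot]

theorem const_of_adj {α : Type} (E : PlaneEmb G) (h : V → α)
    (hh : ∀ d : G.Dart, h d.fst = h d.snd) (u v : V) : h u = h v := by
  obtain ⟨w⟩ := E.connected.preconnected u v
  induction w with
  | nil => rfl
  | cons hadj _ ih => exact (hh ⟨(_, _), hadj⟩).trans ih

theorem vertex_const {α : Type} (E : PlaneEmb G) (f : G.Dart → α)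
    (hf : ∀ d, f (E.rot d) = f d) (d d' : G.Dart) (h : d.fst = d'.fst) : f d = f d' := by
  obtain ⟨n, rfl⟩ := E.rot_vertex d d' h
  induction n with
  | zero => rfl
  | succ n ih =>
    rw [pow_succ']
    change f d = f (E.rot ((E.rot ^ n) d))
    rw [hf]
    apply ih
    rw [h, pow_succ']
    exact E.rot_fst _

theorem face_const (ρ : E.Face → ℝ)
    (h : ∀ d, ρ (E.dartFace d) = ρ (E.dartFace d.symm)) (F F' : E.Face) : ρ F = ρ F' := by
  have hv : ∀ d d' : G.Dart, d.fst = d'.fst → ρ (E.dartFace d) = ρ (E.dartFace d') :=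
    vertex_const E (fun d => ρ (E.dartFace d)) (fun d => by rw [dartFace_rot, ← h])
  choose δ hδ using exists_dart E
  have hk := const_of_adj E (fun v => ρ (E.dartFace (δ v))) (by
    intro d
    have h1 := hv (δ d.fst) d (hδ _)
    have h2 := hv (δ d.snd) d.symm (hδ _)
    simp only [h1, h2, h d])
  obtain ⟨d, rfl⟩ := Quotient.exists_rep F
  obtain ⟨d', rfl⟩ := Quotient.exists_rep F'
  have h1 := hv (δ d.fst) d (hδ _)
  have h2 := hv (δ d'.fst) d' (hδ _)
  exact h1.symm.trans ((hk d.fst d'.fst).trans h2)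

noncomputable def psiMap (E : PlaneEmb G) (v0 : V) :
    ((G.edgeSet → ℝ) × (V → ℝ) × (E.Face → ℝ)) →ₗ[ℝ] ((G.Dart → ℝ) × ℝ × ℝ) where
  toFun x := (fun d => x.1 ⟨d.edge, d.edge_mem⟩ + (x.2.1 d.snd - x.2.1 d.fst)
      + (x.2.2 (E.dartFace d) - x.2.2 (E.dartFace d.symm)), x.2.1 v0, x.2.2 E.outer)
  map_add' x y := by
    refine Prod.ext ?_ (Prod.ext rfl rfl)
    funext d
    simp only [Prod.fst_add, Prod.snd_add, Pi.add_apply]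
    ring
  map_smul' a x := by
    refine Prod.ext ?_ (Prod.ext rfl rfl)
    funext d
    simp only [Prod.smul_fst, Prod.smul_snd, Pi.smul_apply, smul_eq_mul, RingHom.id_apply]
    ring

theorem decomp_symm (s : G.edgeSet → ℝ) (h : V → ℝ) (ρ : E.Face → ℝ) (c : G.Dart → ℝ)
    (hc : ∀ d, c d.symm = - c d)
    (hcl : ∀ v, ∑ d ∈ Finset.univ.filter (fun d : G.Dart => d.fst = v), c d = 0)
    (H : ∀ d : G.Dart, s ⟨d.edge, d.edge_mem⟩ + (h d.snd - h d.fst)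
      + (ρ (E.dartFace d) - ρ (E.dartFace d.symm)) = c d) :
    s = 0 ∧ (∀ d : G.Dart, h d.fst = h d.snd) ∧
      ∀ d, ρ (E.dartFace d) - ρ (E.dartFace d.symm) = c d := by
  have hs : s = 0 := by
    funext ⟨e, he⟩
    induction e with
    | _ a b =>
    let d : G.Dart := ⟨(a, b), he⟩
    have h1 := H d
    have h2 := H d.symm
    have h3 : (⟨d.symm.edge, d.symm.edge_mem⟩ : G.edgeSet) = ⟨d.edge, d.edge_mem⟩ :=
      Subtype.ext d.edge_symm
    rw [h3, SimpleGraph.Dart.symm_symm, hc] at h2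
    change _ + (h d.fst - h d.snd) + _ = _ at h2
    change s ⟨d.edge, d.edge_mem⟩ = 0
    linarith
  subst hs
  set c' : G.Dart → ℝ := fun d => c d - (ρ (E.dartFace d) - ρ (E.dartFace d.symm)) with hc'
  have e : ∀ d : G.Dart, h d.snd - h d.fst = c' d := by
    intro d; have := H d; simp only [Pi.zero_apply] at this; simp only [hc']; linarith
  have h0 := orth_closed h c' (by intro d; simp only [hc', hc, SimpleGraph.Dart.symm_symm]; ring)
    (by intro v; simp only [hc']; rw [Finset.sum_sub_distrib, hcl, closed_face, sub_zero])
  simp only [e] at h0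
  rw [Finset.sum_eq_zero_iff_of_nonneg (fun d _ => mul_self_nonneg _)] at h0
  have h1 : ∀ d, c' d = 0 := fun d => mul_self_eq_zero.mp (h0 d (Finset.mem_univ _))
  refine ⟨rfl, fun d => ?_, fun d => ?_⟩
  · have := e d; rw [h1] at this; linarith
  · have := h1 d; simp only [hc'] at this; linarith

theorem exact_of_closed (E : PlaneEmb G) (c : G.Dart → ℝ) (hc : ∀ d, c d.symm = - c d)
    (hcl : ∀ v, ∑ d ∈ Finset.univ.filter (fun d : G.Dart => d.fst = v), c d = 0) :
    ∃ ρ : E.Face → ℝ, ρ E.outer = 0 ∧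
      ∀ d, ρ (E.dartFace d) - ρ (E.dartFace d.symm) = c d := by
  have := Fintype.ofFinite E.Face
  obtain ⟨d0, -⟩ := Quotient.exists_rep E.outer
  have hinj : Function.Injective (psiMap E d0.fst) := by
    rw [← LinearMap.ker_eq_bot, LinearMap.ker_eq_bot']
    rintro ⟨s, h, ρ⟩ H
    simp only [psiMap, LinearMap.coe_mk, AddHom.coe_mk, Prod.mk_eq_zero] at H
    obtain ⟨H1, H2, H3⟩ := H
    obtain ⟨hs, hh, hρ⟩ := decomp_symm s h ρ 0 (by simp) (by simp) (fun d => congrFun H1 d)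
    refine Prod.ext hs (Prod.ext ?_ ?_)
    · funext v
      exact (const_of_adj E h hh v d0.fst).trans H2
    · funext F
      exact (face_const ρ (fun d => sub_eq_zero.mp (hρ d)) F E.outer).trans H3
  have hdim : Module.finrank ℝ ((G.edgeSet → ℝ) × (V → ℝ) × (E.Face → ℝ))
      = Module.finrank ℝ ((G.Dart → ℝ) × ℝ × ℝ) := by
    simp only [Module.finrank_prod, Module.finrank_fintype_fun_eq_card, Module.finrank_self]
    rw [card_darts]
    have h3 := E.euler
    change Nat.card V + Nat.card E.Face = _ at h3
    simp only [Nat.card_eq_fintype_card] at h3 ⊢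
    omega
  have hsurj := (LinearMap.injective_iff_surjective_of_finrank_eq_finrank hdim).mp hinj
  obtain ⟨⟨s, h, ρ⟩, H⟩ := hsurj (c, 0, 0)
  simp only [psiMap, LinearMap.coe_mk, AddHom.coe_mk, Prod.mk.injEq] at H
  exact ⟨ρ, H.2.2, (decomp_symm s h ρ c hc hcl (fun d => congrFun H.1 d)).2.2⟩

open Classical in
/-- edge count of a pseudo-triangulation -/
theorem edge_count (hc : IsCPTLabelling E big) :
    Nat.card G.edgeSet + 3
      = 2 * Nat.card V + (Finset.univ.filter (fun v => ¬ PointedVx big v)).card := by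
  have := Fintype.ofFinite E.Face
  have h1 : (Finset.univ.filter (fun d : G.Dart => ¬ big d.symm)).card
      = 3 * (Nat.card E.Face - 1) := by
    rw [Finset.card_eq_sum_card_fiberwise (f := fun d => E.dartFace d) (t := Finset.univ)
      (by simp)]
    simp only [Finset.filter_filter]
    have h2 : ∀ F : E.Face,
        (Finset.univ.filter (fun d : G.Dart => ¬ big d.symm ∧ E.dartFace d = F)).card
        = if F = E.outer then 0 else 3 := by
      intro F
      split_ifs with hF
      · rw [Finset.card_eq_zero, Finset.filter_eq_empty_iff]
        rintro d - ⟨hb, hf⟩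
        apply hb
        apply hc.outer_big
        change E.dartFace d.symm.symm = _
        rw [SimpleGraph.Dart.symm_symm, hf, hF]
      · rw [← card_small hc F hF]
        congr 1; ext d; simp [and_comm]
    rw [Finset.sum_congr rfl fun F _ => h2 F, Finset.sum_ite]
    simp [Finset.filter_ne', Finset.card_erase_of_mem, mul_comm]
  have h1' : (Finset.univ.filter (fun d : G.Dart => ¬ big d)).card
      = 3 * (Nat.card E.Face - 1) := by
    rw [← h1]
    apply Finset.card_equiv (dartSymmPerm G)
    intro d
    simp only [Finset.mem_filter, Finset.mem_univ, true_and]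
    change _ ↔ ¬ big d.symm.symm
    rw [SimpleGraph.Dart.symm_symm]
  have h2 : (Finset.univ.filter (fun d : G.Dart => big d)).card
      = (Finset.univ.filter (fun v => PointedVx big v)).card := by
    apply Finset.card_bij (fun d _ => d.fst)
    · intro d hd
      simp only [Finset.mem_filter, Finset.mem_univ, true_and] at hd ⊢
      exact ⟨d, hd, rfl⟩
    · intro d hd d' hd' h
      simp only [Finset.mem_filter, Finset.mem_univ, true_and] at hd hd'
      exact hc.one_big d d' hd hd' h
    · intro v hv
      simp only [Finset.mem_filter, Finset.mem_univ, true_and] at hv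
      obtain ⟨d, hd, e⟩ := hv
      exact ⟨d, by simpa using hd, e⟩
  have h3 : (Finset.univ.filter (fun d : G.Dart => big d)).card
      + (Finset.univ.filter (fun d : G.Dart => ¬ big d)).card = 2 * Nat.card G.edgeSet := by
    rw [← card_darts, ← Finset.card_univ]
    convert Finset.card_filter_add_card_filter_not (s := (Finset.univ : Finset G.Dart)) big
  have h4 : (Finset.univ.filter (fun v : V => PointedVx big v)).card
      + (Finset.univ.filter (fun v : V => ¬ PointedVx big v)).card = Nat.card V := by
    rw [Nat.card_eq_fintype_card, ← Finset.card_univ]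
    convert Finset.card_filter_add_card_filter_not (s := (Finset.univ : Finset V))
      (fun v => PointedVx big v)
  have h5 := E.euler
  change Nat.card V + Nat.card E.Face = _ at h5
  have h6 : 0 < Nat.card E.Face := by
    have : Nonempty E.Face := ⟨E.outer⟩
    exact Nat.card_pos
  omega

end PTpart


section PTpart
set_option linter.unusedSectionVars false
variable {V : Type} [Fintype V] [DecidableEq V] {G : SimpleGraph V} [DecidableRel G.Adj]
variable {E : PlaneEmb G} {big : G.Dart → Prop} {p : V → ℝ × ℝ}

structure IsLift (E : PlaneEmb G) (p : V → ℝ × ℝ) (A B C : E.Face → ℝ) (w : G.Dart → ℝ) :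
    Prop where
  jA : ∀ d, A (E.dartFace d) - A (E.dartFace d.symm) = w d * (-((p d.snd).2 - (p d.fst).2))
  jB : ∀ d, B (E.dartFace d) - B (E.dartFace d.symm) = w d * ((p d.snd).1 - (p d.fst).1)
  jC : ∀ d, C (E.dartFace d) - C (E.dartFace d.symm)
    = w d * ((p d.fst).1 * (p d.snd).2 - (p d.snd).1 * (p d.fst).2)
  oA : A E.outer = 0
  oB : B E.outer = 0
  oC : C E.outer = 0

noncomputable def someDart (E : PlaneEmb G) (v : V) : G.Dart := (exists_dart E v).choose

theorem someDart_fst (E : PlaneEmb G) (v : V) : (someDart E v).fst = v :=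
  (exists_dart E v).choose_spec

noncomputable def hgt (E : PlaneEmb G) (p : V → ℝ × ℝ) (A B C : E.Face → ℝ) (v : V) : ℝ :=
  A (E.dartFace (someDart E v)) * (p v).1 + B (E.dartFace (someDart E v)) * (p v).2
    + C (E.dartFace (someDart E v))

variable {A B C : E.Face → ℝ} {w : G.Dart → ℝ}

theorem IsLift.hgt_fst (h : IsLift E p A B C w) (d : G.Dart) :
    A (E.dartFace d) * (p d.fst).1 + B (E.dartFace d) * (p d.fst).2 + C (E.dartFace d)
      = hgt E p A B C d.fst := by
  have := vertex_const E (fun d => A (E.dartFace d) * (p d.fst).1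
    + B (E.dartFace d) * (p d.fst).2 + C (E.dartFace d)) (by
      intro d
      simp only [dartFace_rot, E.rot_fst]
      linear_combination -(p d.fst).1 * h.jA d - (p d.fst).2 * h.jB d - h.jC d)
      d (someDart E d.fst) (someDart_fst E _).symm
  refine this.trans ?_
  simp only [someDart_fst]
  rfl

theorem IsLift.hgt_fst' (h : IsLift E p A B C w) (d : G.Dart) :
    A (E.dartFace d.symm) * (p d.fst).1 + B (E.dartFace d.symm) * (p d.fst).2
      + C (E.dartFace d.symm) = hgt E p A B C d.fst := by
  have := h.hgt_fst (E.rot d)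
  rwa [dartFace_rot, E.rot_fst] at this

theorem IsLift.hgt_snd (h : IsLift E p A B C w) (d : G.Dart) :
    A (E.dartFace d) * (p d.snd).1 + B (E.dartFace d) * (p d.snd).2 + C (E.dartFace d)
      = hgt E p A B C d.snd := by
  have := h.hgt_fst' d.symm
  rwa [SimpleGraph.Dart.symm_symm] at this

theorem IsLift.neg (h : IsLift E p A B C w) : IsLift E p (-A) (-B) (-C) (-w) where
  jA d := by simp only [Pi.neg_apply]; linear_combination - h.jA d
  jB d := by simp only [Pi.neg_apply]; linear_combination - h.jB d
  jC d := by simp only [Pi.neg_apply]; linear_combination - h.jC d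
  oA := by simp [h.oA]
  oB := by simp [h.oB]
  oC := by simp [h.oC]

theorem hgt_nonpos (hc : IsCPTLabelling E big) (hs : Stretches G E big p)
    (h : IsLift E p A B C w) (S : Set V) (hw : ∀ d : G.Dart, d.fst ∉ S → w d = 0)
    (h0 : ∀ v ∈ S, ¬ PointedVx big v → hgt E p A B C v ≤ 0) (v : V) :
    hgt E p A B C v ≤ 0 := by
  by_contra hpos
  push Not at hpos
  set H := hgt E p A B C with hH
  obtain ⟨m, -, hm⟩ := Finset.exists_max_image Finset.univ H ⟨v, Finset.mem_univ _⟩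
  obtain ⟨x, hx, hxm⟩ := Finset.exists_max_image (Finset.univ.filter (fun y => H y = H m))
    (fun y => (p y).1) ⟨m, by simp⟩
  simp only [Finset.mem_filter, Finset.mem_univ, true_and] at hx hxm
  replace hm : ∀ y, H y ≤ H m := fun y => hm y (Finset.mem_univ _)
  have hmpos : 0 < H m := lt_of_lt_of_le hpos (hm v)
  -- a set surrounding x on which H is affine
  have key : ∃ (F : E.Face) (U : Set V), A F * (p x).1 + B F * (p x).2 + C F = H x ∧
      (∀ y ∈ U, A F * (p y).1 + B F * (p y).2 + C F = H y) ∧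
      ∀ a b : ℝ, (a ≠ 0 ∨ b ≠ 0) →
        ∃ y ∈ U, 0 < a * ((p y).1 - (p x).1) + b * ((p y).2 - (p x).2) := by
    by_cases hpt : PointedVx big x
    · obtain ⟨d, hd, hdx⟩ := hpt
      refine ⟨E.angleFace d, {y | ∃ e : G.Dart, E.dartFace e = E.angleFace d ∧ e.fst = y},
        ?_, ?_, ?_⟩
      · rw [← hdx]; exact h.hgt_fst' d
      · rintro y ⟨e, he, rfl⟩
        rw [← he]; exact h.hgt_fst e
      · intro a b hab
        have hF : E.angleFace d ≠ E.outer := by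
          intro hF
          have h1 : A (E.angleFace d) * (p d.fst).1 + B (E.angleFace d) * (p d.fst).2
            + C (E.angleFace d) = H d.fst := h.hgt_fst' d
          rw [hF, h.oA, h.oB, h.oC, hdx, hx] at h1
          linarith
        obtain ⟨e, he, hpos⟩ := big_surround hc hs d hd hF a b hab
        rw [hdx] at hpos
        exact ⟨e.fst, ⟨e, he, rfl⟩, hpos⟩
    · have hxS : x ∉ S := by
        intro hxS
        have := h0 x hxS hpt
        linarith
      have hcon : ∀ d d' : G.Dart, d.fst = x → d'.fst = x →
          A (E.dartFace d) = A (E.dartFace d') ∧ B (E.dartFace d) = B (E.dartFace d') ∧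
          C (E.dartFace d) = C (E.dartFace d') := by
        intro d d' hd hd'
        obtain ⟨n, rfl⟩ := E.rot_vertex d d' (hd.trans hd'.symm)
        clear hd'
        induction n with
        | zero => exact ⟨rfl, rfl, rfl⟩
        | succ n ih =>
          obtain ⟨i1, i2, i3⟩ := ih
          have hfst : ((E.rot ^ n) d).fst = x := by
            clear i1 i2 i3
            induction n with
            | zero => exact hd
            | succ n ih =>
              rw [pow_succ']
              exact (E.rot_fst _).trans ih
          have hw0 := hw ((E.rot ^ n) d) (by rw [hfst]; exact hxS)
          have jA := h.jA ((E.rot ^ n) d)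
          have jB := h.jB ((E.rot ^ n) d)
          have jC := h.jC ((E.rot ^ n) d)
          rw [hw0, zero_mul, sub_eq_zero] at jA jB jC
          rw [pow_succ']
          change _ = A (E.dartFace (E.rot ((E.rot ^ n) d))) ∧
            _ = B (E.dartFace (E.rot ((E.rot ^ n) d))) ∧
            _ = C (E.dartFace (E.rot ((E.rot ^ n) d)))
          rw [dartFace_rot, i1, i2, i3]
          exact ⟨jA, jB, jC⟩
      refine ⟨E.dartFace (someDart E x), {y | ∃ e : G.Dart, e.fst = x ∧ e.snd = y}, rfl, ?_, ?_⟩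
      · rintro y ⟨e, he, rfl⟩
        obtain ⟨i1, i2, i3⟩ := hcon (someDart E x) e (someDart_fst E x) he
        rw [i1, i2, i3]
        exact h.hgt_snd e
      · intro a b hab
        obtain ⟨d, hd, hpos⟩ := nonpointed_surround hs x hpt a b hab
        refine ⟨d.snd, ⟨d, hd, rfl⟩, ?_⟩
        simpa [dz, cpx, hd] using hpos
  obtain ⟨F, U, hxF, hU, hsur⟩ := key
  by_cases hab : A F ≠ 0 ∨ B F ≠ 0
  · obtain ⟨y, hy, hlt⟩ := hsur _ _ hab
    have := hU y hy
    have := hm y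
    linarith
  · push Not at hab
    obtain ⟨hA, hB⟩ := hab
    obtain ⟨y, hy, hlt⟩ := hsur 1 0 (Or.inl one_ne_zero)
    have h1 := hU y hy
    rw [hA, hB] at h1 hxF
    have := hxm y (by linarith)
    linarith

theorem lift_zero (hc : IsCPTLabelling E big) (hs : Stretches G E big p)
    (h : IsLift E p A B C w) (S : Set V) (hw : ∀ d : G.Dart, d.fst ∉ S → w d = 0)
    (h0 : ∀ v ∈ S, ¬ PointedVx big v → hgt E p A B C v = 0) : w = 0 := by
  have h1 := hgt_nonpos hc hs h S hw (fun v hv hp => (h0 v hv hp).le)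
  have hneg : ∀ v, hgt E p (-A) (-B) (-C) v = - hgt E p A B C v := by
    intro v; simp only [hgt, Pi.neg_apply]; ring
  have h2 := hgt_nonpos hc hs h.neg S (fun d hd => by simp [hw d hd])
    (fun v hv hp => by rw [hneg, h0 v hv hp, neg_zero])
  have hz : ∀ v, hgt E p A B C v = 0 := by
    intro v
    have := h2 v
    rw [hneg] at this
    have := h1 v
    linarith
  have hface : ∀ F, A F = 0 ∧ B F = 0 := by
    intro F
    by_cases hF : F = E.outer
    · rw [hF]; exact ⟨h.oA, h.oB⟩
    · have h3 := hc.bounded_small F hF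
      obtain ⟨⟨d, hd, hsm⟩⟩ : Nonempty {d : G.Dart | E.angleFace d = F ∧ ¬ big d} := by
        by_contra hne
        rw [not_nonempty_iff] at hne
        rw [Nat.card_of_isEmpty] at h3
        omega
      have e1 := h.hgt_fst' d
      have e2 := h.hgt_snd d.symm
      have e2 := h.hgt_fst d.symm
      have e3 := h.hgt_snd (E.rot d)
      rw [dartFace_rot] at e3
      change E.dartFace d.symm = F at hd
      change _ * (p d.snd).1 + _ * (p d.snd).2 + _ = _ at e2
      rw [hz, hd] at e1 e2 e3
      have hdet := small_det hs d hsm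
      simp only [dz, cpx, E.rot_fst, Prod.fst_sub, Prod.snd_sub] at hdet
      set D := ((p d.snd).1 - (p d.fst).1) * ((p (E.rot d).snd).2 - (p d.fst).2)
        - ((p d.snd).2 - (p d.fst).2) * ((p (E.rot d).snd).1 - (p d.fst).1) with hD
      constructor
      · apply (mul_eq_zero.mp (show A F * D = 0 from ?_)).resolve_right hdet
        rw [hD]
        linear_combination ((p (E.rot d).snd).2 - (p d.fst).2) * (e2 - e1)
          - ((p d.snd).2 - (p d.fst).2) * (e3 - e1)
      · apply (mul_eq_zero.mp (show B F * D = 0 from ?_)).resolve_right hdet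
        rw [hD]
        linear_combination -((p (E.rot d).snd).1 - (p d.fst).1) * (e2 - e1)
          + ((p d.snd).1 - (p d.fst).1) * (e3 - e1)
  funext d
  by_contra hne
  have jA := h.jA d
  have jB := h.jB d
  rw [(hface _).1, (hface _).1, sub_zero] at jA
  rw [(hface _).2, (hface _).2, sub_zero] at jB
  have a1 := (mul_eq_zero.mp jA.symm).resolve_left hne
  have b1 := (mul_eq_zero.mp jB.symm).resolve_left hne
  exact d.adj.ne (hs.1.1 (Prod.ext (by linarith) (by linarith)))

theorem exists_lift (E : PlaneEmb G) (p : V → ℝ × ℝ) (w : G.Dart → ℝ)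
    (hsym : ∀ d, w d.symm = w d)
    (heq : ∀ (v : V) (t : ℝ × ℝ), ∑ d ∈ Finset.univ.filter (fun d : G.Dart => d.fst = v),
      w d * dot2 (p d.fst - p d.snd) t = 0) :
    ∃ A B C : E.Face → ℝ, IsLift E p A B C w := by
  obtain ⟨A, hA, jA⟩ := exact_of_closed E (fun d => w d * (-((p d.snd).2 - (p d.fst).2)))
    (by intro d; simp only [hsym]; change w d * (-((p d.fst).2 - (p d.snd).2)) = _; ring) (by
      intro v
      rw [← heq v (0, 1)]
      apply Finset.sum_congr rfl
      intro d _
      simp [dot2])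
  obtain ⟨B, hB, jB⟩ := exact_of_closed E (fun d => w d * ((p d.snd).1 - (p d.fst).1))
    (by intro d; simp only [hsym]; change w d * ((p d.fst).1 - (p d.snd).1) = _; ring) (by
      intro v
      rw [← heq v (-1, 0)]
      apply Finset.sum_congr rfl
      intro d _
      simp [dot2])
  obtain ⟨C, hC, jC⟩ := exact_of_closed E
    (fun d => w d * ((p d.fst).1 * (p d.snd).2 - (p d.snd).1 * (p d.fst).2))
    (by intro d; simp only [hsym]; change w d * ((p d.snd).1 * (p d.fst).2 - (p d.fst).1 * (p d.snd).2) = _; ring) (by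
      intro v
      rw [← heq v ((p v).2, -(p v).1)]
      apply Finset.sum_congr rfl
      intro d hd
      rw [← (Finset.mem_filter.mp hd).2]
      simp [dot2]
      left; ring)
  exact ⟨A, B, C, ⟨jA, jB, jC, hA, hB, hC⟩⟩

end PTpart


section PTpart
set_option linter.unusedSectionVars false
variable {V : Type} [Fintype V] [DecidableEq V] {G : SimpleGraph V} [DecidableRel G.Adj]
variable {E : PlaneEmb G} {big : G.Dart → Prop} {p : V → ℝ × ℝ}

def rv (p q : V → ℝ × ℝ) : Sym2 V → ℝ :=
  Sym2.lift ⟨fun u v => dot2 (p u - p v) (q u - q v), by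
    intro u v; simp only [dot2, Prod.fst_sub, Prod.snd_sub]; ring⟩

theorem rv_mk (p q : V → ℝ × ℝ) (u v : V) :
    rv p q s(u, v) = dot2 (p u - p v) (q u - q v) := rfl

def rigMap (p : V → ℝ × ℝ) (T : Finset (Sym2 V)) : (V → ℝ × ℝ) →ₗ[ℝ] (T → ℝ) where
  toFun q e := rv p q e.1
  map_add' q q' := by
    funext ⟨e, he⟩
    induction e using Sym2.ind with
    | _ u v => simp only [rv_mk, Pi.add_apply, dot2, Prod.fst_sub, Prod.snd_sub,
        Prod.fst_add, Prod.snd_add]; ring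
  map_smul' c q := by
    funext ⟨e, he⟩
    induction e using Sym2.ind with
    | _ u v => simp only [rv_mk, Pi.smul_apply, dot2, Prod.fst_sub, Prod.snd_sub,
        Prod.smul_fst, Prod.smul_snd, smul_eq_mul, RingHom.id_apply]; ring

def wmap (G : SimpleGraph V) (T : Finset (Sym2 V)) :
    Module.Dual ℝ (T → ℝ) →ₗ[ℝ] (G.Dart → ℝ) where
  toFun φ d := if h : d.edge ∈ T then φ (Pi.single ⟨d.edge, h⟩ 1) else 0
  map_add' φ ψ := by
    funext d; by_cases h : d.edge ∈ T <;> simp [h]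
  map_smul' c φ := by
    funext d; by_cases h : d.edge ∈ T <;> simp [h]

theorem dart_sum (G : SimpleGraph V) [DecidableRel G.Adj] (f : Sym2 V → ℝ) :
    ∑ d : G.Dart, f d.edge = 2 * ∑ s ∈ G.edgeFinset, f s := by
  rw [← Finset.sum_fiberwise_of_maps_to (s := Finset.univ) (t := G.edgeFinset)
    (g := fun d : G.Dart => d.edge) (fun d _ => by simp), Finset.mul_sum]
  apply Finset.sum_congr rfl
  intro s hs
  rw [Finset.sum_congr rfl (g := fun _ => f s) (fun d hd => by rw [(Finset.mem_filter.mp hd).2]),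
    Finset.sum_const, G.dart_edge_fiber_card s (by simpa using hs)]
  simp

theorem wmap_symm (T : Finset (Sym2 V)) (φ : Module.Dual ℝ (T → ℝ)) (d : G.Dart) :
    wmap G T φ d.symm = wmap G T φ d := by
  have h : ∀ s s' : Sym2 V, s = s' →
      (if h : s ∈ T then φ (Pi.single ⟨s, h⟩ 1) else 0)
        = if h : s' ∈ T then φ (Pi.single ⟨s', h⟩ 1) else 0 := by
    rintro s _ rfl; rfl
  exact h _ _ d.edge_symm

theorem wmap_rv (T : Finset (Sym2 V)) (hT : T ⊆ G.edgeFinset)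
    (φ : Module.Dual ℝ (T → ℝ)) (hφ : φ ∈ (LinearMap.range (rigMap p T)).dualAnnihilator)
    (q : V → ℝ × ℝ) :
    ∑ d : G.Dart, wmap G T φ d * dot2 (p d.fst - p d.snd) (q d.fst - q d.snd) = 0 := by
  have h1 : φ (rigMap p T q) = 0 :=
    (Submodule.mem_dualAnnihilator φ).mp hφ _ ⟨q, rfl⟩
  rw [LinearMap.pi_apply_eq_sum_univ] at h1
  set Om : Sym2 V → ℝ := fun s => if h : s ∈ T then φ (Pi.single ⟨s, h⟩ 1) else 0 with hOm
  have h2 := dart_sum G (fun s => Om s * rv p q s)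
  refine h2.trans ?_
  rw [← Finset.sum_subset hT (fun s _ hs => by simp [hOm, hs]), ← Finset.sum_coe_sort T]
  rw [mul_eq_zero]; right
  rw [← h1]
  apply Finset.sum_congr rfl
  rintro ⟨s, hs⟩ _
  simp only [hOm, hs, dite_true, smul_eq_mul]
  rw [mul_comm]
  congr 2
  funext t
  by_cases ht : t = ⟨s, hs⟩
  · subst ht; simp
  · simp [ht, eq_comm]

theorem wmap_equil (T : Finset (Sym2 V)) (hT : T ⊆ G.edgeFinset)
    (φ : Module.Dual ℝ (T → ℝ)) (hφ : φ ∈ (LinearMap.range (rigMap p T)).dualAnnihilator)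
    (v : V) (t : ℝ × ℝ) : ∑ d ∈ Finset.univ.filter (fun d : G.Dart => d.fst = v),
      wmap G T φ d * dot2 (p d.fst - p d.snd) t = 0 := by
  set q : V → ℝ × ℝ := Pi.single v t with hq
  have h := wmap_rv T hT φ hφ q
  have h1 : ∑ d : G.Dart, wmap G T φ d * dot2 (p d.fst - p d.snd) (q d.fst - q d.snd)
      = ∑ d : G.Dart, wmap G T φ d * dot2 (p d.fst - p d.snd) (q d.fst)
        + ∑ d : G.Dart, wmap G T φ d * dot2 (p d.snd - p d.fst) (q d.snd) := by
    rw [← Finset.sum_add_distrib]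
    apply Finset.sum_congr rfl
    intro d _
    simp only [dot2, Prod.fst_sub, Prod.snd_sub]; ring
  have h2 : ∑ d : G.Dart, wmap G T φ d * dot2 (p d.snd - p d.fst) (q d.snd)
      = ∑ d : G.Dart, wmap G T φ d * dot2 (p d.fst - p d.snd) (q d.fst) := by
    rw [← Equiv.sum_comp (dartSymmPerm G)]
    apply Finset.sum_congr rfl
    intro d _
    change wmap G T φ d.symm * dot2 (p d.fst - p d.snd) (q d.fst) = _
    rw [wmap_symm]
  rw [h1, h2] at h
  rw [Finset.sum_filter]
  refine (Finset.sum_congr rfl ?_).trans (show ∑ d : G.Dart, wmap G T φ d *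
    dot2 (p d.fst - p d.snd) (q d.fst) = 0 by linarith)
  intro d _
  by_cases hd : d.fst = v
  · subst hd; simp [hq]
  · simp [hq, hd, dot2]

theorem IsLift.add {A B C A' B' C' : E.Face → ℝ} {w w' : G.Dart → ℝ}
    (h : IsLift E p A B C w) (h' : IsLift E p A' B' C' w') :
    IsLift E p (A + A') (B + B') (C + C') (w + w') where
  jA d := by simp only [Pi.add_apply]; linear_combination h.jA d + h'.jA d
  jB d := by simp only [Pi.add_apply]; linear_combination h.jB d + h'.jB d
  jC d := by simp only [Pi.add_apply]; linear_combination h.jC d + h'.jC d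
  oA := by simp [h.oA, h'.oA]
  oB := by simp [h.oB, h'.oB]
  oC := by simp [h.oC, h'.oC]

theorem IsLift.smul {A B C : E.Face → ℝ} {w : G.Dart → ℝ}
    (h : IsLift E p A B C w) (c : ℝ) :
    IsLift E p (c • A) (c • B) (c • C) (c • w) where
  jA d := by simp only [Pi.smul_apply, smul_eq_mul]; linear_combination c * h.jA d
  jB d := by simp only [Pi.smul_apply, smul_eq_mul]; linear_combination c * h.jB d
  jC d := by simp only [Pi.smul_apply, smul_eq_mul]; linear_combination c * h.jC d
  oA := by simp [h.oA]
  oB := by simp [h.oB]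
  oC := by simp [h.oC]

open Classical in
theorem lift_bound (hc : IsCPTLabelling E big) (hs : Stretches G E big p) (S : Set V)
    {D : Type} [AddCommGroup D] [Module ℝ D] (W : D →ₗ[ℝ] (G.Dart → ℝ))
    (hW : Function.Injective W) (hS : ∀ x d, d.fst ∉ S → W x d = 0)
    (hlift : ∀ x, ∃ A B C : E.Face → ℝ, IsLift E p A B C (W x)) :
    Module.finrank ℝ D ≤
      (Finset.univ.filter (fun v => v ∈ S ∧ ¬ PointedVx big v)).card := by
  let R : Submodule ℝ ((E.Face → ℝ) × (E.Face → ℝ) × (E.Face → ℝ) × D) :=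
    { carrier := {x | IsLift E p x.1 x.2.1 x.2.2.1 (W x.2.2.2)}
      add_mem' := by
        intro a b ha hb
        have := IsLift.add ha hb
        rw [← map_add] at this
        exact this
      zero_mem' := by
        have : IsLift E p 0 0 0 (W 0) := by
          rw [map_zero]
          constructor <;> simp
        exact this
      smul_mem' := by
        intro c a ha
        have := IsLift.smul ha c
        rw [← map_smul] at this
        exact this }
  let π : R →ₗ[ℝ] D := (LinearMap.snd ℝ _ _ ∘ₗ LinearMap.snd ℝ _ _ ∘ₗ LinearMap.snd ℝ _ _)
    ∘ₗ R.subtype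
  have hπ : Function.Surjective π := by
    intro φ
    obtain ⟨A, B, C, h⟩ := hlift φ
    exact ⟨⟨(A, B, C, φ), h⟩, rfl⟩
  obtain ⟨s, hsec⟩ := LinearMap.exists_rightInverse_of_surjective π (LinearMap.range_eq_top.mpr hπ)
  let Z := {v // v ∈ S ∧ ¬ PointedVx big v}
  let g : R →ₗ[ℝ] (Z → ℝ) :=
    { toFun := fun x v => hgt E p x.1.1 x.1.2.1 x.1.2.2.1 v.1
      map_add' := by
        intro x y; funext v
        simp only [hgt, Submodule.coe_add, Prod.fst_add, Prod.snd_add, Pi.add_apply]; ring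
      map_smul' := by
        intro c x; funext v
        simp only [hgt, Submodule.coe_smul, Prod.smul_fst, Prod.smul_snd, Pi.smul_apply,
          smul_eq_mul, RingHom.id_apply]; ring }
  have hinj : Function.Injective (g ∘ₗ s) := by
    refine (injective_iff_map_eq_zero (g ∘ₗ s)).mpr ?_
    intro φ hφ
    have hl : IsLift E p (s φ).1.1 (s φ).1.2.1 (s φ).1.2.2.1 (W (s φ).1.2.2.2) := (s φ).2
    have hφ' : (s φ).1.2.2.2 = φ := LinearMap.congr_fun hsec φ
    rw [hφ'] at hl
    have hw : W φ = 0 := by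
      apply lift_zero hc hs hl S (hS φ)
      intro v hv hp
      exact congrFun hφ ⟨v, hv, hp⟩
    apply hW
    rw [hw, map_zero]
  have := LinearMap.finrank_le_finrank_of_injective hinj
  rw [Module.finrank_fintype_fun_eq_card, Fintype.card_subtype] at this
  exact this

theorem wmap_inj (T : Finset (Sym2 V)) (hT : T ⊆ G.edgeFinset) :
    Function.Injective (wmap G T) := by
  intro φ ψ hw
  apply LinearMap.pi_ext'
  rintro ⟨e, he⟩
  apply LinearMap.ext_ring
  have heG := hT he
  induction e using Sym2.ind with
  | _ u v =>
    have hadj : G.Adj u v := by simpa using heG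
    have := congrFun hw ⟨(u, v), hadj⟩
    have he' : (⟨(u, v), hadj⟩ : G.Dart).edge ∈ T := he
    simp only [wmap, LinearMap.coe_mk, AddHom.coe_mk, he', dite_true] at this
    exact this

open Classical in
theorem stress_bound (hc : IsCPTLabelling E big) (hs : Stretches G E big p) (S : Set V)
    (T : Finset (Sym2 V)) (hT : T ⊆ G.edgeFinset) (hTS : ∀ e ∈ T, ∀ v ∈ e, v ∈ S) :
    Module.finrank ℝ (LinearMap.range (rigMap p T)).dualAnnihilator ≤
      (Finset.univ.filter (fun v => v ∈ S ∧ ¬ PointedVx big v)).card := by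
  refine lift_bound (D := ↥(LinearMap.range (rigMap p T)).dualAnnihilator) hc hs S
    { toFun := fun x => wmap G T x.1
      map_add' := fun x y => map_add (wmap G T) x.1 y.1
      map_smul' := fun c x => map_smul (wmap G T) c x.1 } ?_ ?_ ?_
  · exact (wmap_inj T hT).comp Subtype.val_injective
  · intro x d hd
    have : d.edge ∉ T := fun hh => hd (hTS _ hh _ (by
      rw [SimpleGraph.Dart.edge]; exact Sym2.mem_mk_left _ _))
    simp [wmap, this]
  · rintro ⟨φ, hφ⟩
    exact exists_lift E p (wmap G T φ) (wmap_symm T φ) (wmap_equil T hT φ hφ)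

open Classical in
theorem rank_bound (hc : IsCPTLabelling E big) (hs : Stretches G E big p) (S : Set V)
    (T : Finset (Sym2 V)) (hT : T ⊆ G.edgeFinset) (hTS : ∀ e ∈ T, ∀ v ∈ e, v ∈ S) :
    T.card + Module.finrank ℝ (LinearMap.ker (rigMap p T)) ≤
      2 * Fintype.card V + (Finset.univ.filter (fun v => v ∈ S ∧ ¬ PointedVx big v)).card := by
  have h1 := stress_bound hc hs S T hT hTS
  have h2 := Subspace.finrank_add_finrank_dualAnnihilator_eq (LinearMap.range (rigMap p T))
  have h3 := LinearMap.finrank_range_add_finrank_ker (rigMap p T)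
  rw [Module.finrank_fintype_fun_eq_card, Fintype.card_coe] at h2
  have h4 : Module.finrank ℝ (V → ℝ × ℝ) = 2 * Fintype.card V := by
    rw [Module.finrank_pi_fintype]
    simp [Module.finrank_prod, mul_comm]
  omega

end PTpart


section PTpart
set_option linter.unusedSectionVars false
variable {V : Type} [Fintype V] [DecidableEq V] {G : SimpleGraph V} [DecidableRel G.Adj]
variable {E : PlaneEmb G} {big : G.Dart → Prop} {p : V → ℝ × ℝ}

def pin (p : V → ℝ × ℝ) (a b : V) : (V → ℝ × ℝ) →ₗ[ℝ] (ℝ × ℝ) × ℝ where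
  toFun q := (q a, dot2 (rot90 (p b - p a)) (q b - q a))
  map_add' q q' := by
    refine Prod.ext rfl ?_
    simp only [Pi.add_apply, dot2, Prod.fst_sub, Prod.snd_sub, Prod.fst_add, Prod.snd_add]; ring
  map_smul' c q := by
    refine Prod.ext rfl ?_
    simp only [Pi.smul_apply, dot2, Prod.fst_sub, Prod.snd_sub,
        Prod.smul_fst, Prod.smul_snd, smul_eq_mul, RingHom.id_apply]; ring

theorem exists_triv (p : V → ℝ × ℝ) (a b : V) (hab : p a ≠ p b) (z : (ℝ × ℝ) × ℝ) :
    ∃ (c : ℝ) (t : ℝ × ℝ), pin p a b (fun v => c • rot90 (p v) + t) = z := by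
  obtain ⟨⟨x, y⟩, z⟩ := z
  set N := ((p b).1 - (p a).1) ^ 2 + ((p b).2 - (p a).2) ^ 2 with hN
  have hN0 : N ≠ 0 := by
    intro h
    apply hab
    have h1 : ((p b).1 - (p a).1) ^ 2 = 0 := by
      nlinarith [sq_nonneg ((p b).1 - (p a).1), sq_nonneg ((p b).2 - (p a).2)]
    have h2 : ((p b).2 - (p a).2) ^ 2 = 0 := by
      nlinarith [sq_nonneg ((p b).1 - (p a).1), sq_nonneg ((p b).2 - (p a).2)]
    have h1 := pow_eq_zero_iff (two_ne_zero) |>.mp h1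
    have h2 := pow_eq_zero_iff (two_ne_zero) |>.mp h2
    exact Prod.ext (by linarith) (by linarith)
  refine ⟨z / N, (x, y) - (z / N) • rot90 (p a), Prod.ext (Prod.ext ?_ ?_) ?_⟩
  · simp [pin]
  · simp [pin]
  · have : z / N * N = z := div_mul_cancel₀ z hN0
    simp only [pin, LinearMap.coe_mk, AddHom.coe_mk, dot2, rot90, Prod.fst_sub, Prod.snd_sub,
      Prod.fst_add, Prod.snd_add, Prod.smul_fst, Prod.smul_snd, smul_eq_mul]
    linear_combination this - (z / N) * hN

theorem triv_motion (p : V → ℝ × ℝ) (c : ℝ) (t : ℝ × ℝ) (u v : V) :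
    dot2 (p u - p v) ((c • rot90 (p u) + t) - (c • rot90 (p v) + t)) = 0 := by
  simp only [dot2, rot90, Prod.fst_sub, Prod.snd_sub,
      Prod.fst_add, Prod.snd_add, Prod.smul_fst, Prod.smul_snd, smul_eq_mul]
  ring

theorem infRigid_of_pin (G : SimpleGraph V) (p : V → ℝ × ℝ) (a b : V) (hab : p a ≠ p b)
    (h : ∀ q, IsInfMotion G p q → pin p a b q = 0 → q = 0) : InfRigid G p := by
  intro q hq
  obtain ⟨c, t, hct⟩ := exists_triv p a b hab (pin p a b q)
  refine ⟨c, t, fun v => ?_⟩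
  have := h (q - fun v => c • rot90 (p v) + t) (by
    intro u v huv
    have h1 := hq u v huv
    have h2 := triv_motion p c t u v
    simp only [dot2, Prod.fst_sub, Prod.snd_sub, Pi.sub_apply] at h1 h2 ⊢
    linear_combination h1 - h2) (by rw [map_sub, hct, sub_self])
  exact sub_eq_zero.mp (congrFun this v)

open Classical in
theorem ker_lower (p : V → ℝ × ℝ) (S : Set V) (T : Finset (Sym2 V))
    (hTS : ∀ e ∈ T, ∀ v ∈ e, v ∈ S) (a b : V) (ha : a ∈ S) (hb : b ∈ S) (hab : p a ≠ p b) :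
    3 + 2 * Fintype.card {v // v ∉ S} ≤ Module.finrank ℝ (LinearMap.ker (rigMap p T)) := by
  let r : (V → ℝ × ℝ) →ₗ[ℝ] ({v // v ∉ S} → ℝ × ℝ) := LinearMap.funLeft ℝ (ℝ × ℝ) Subtype.val
  let g := ((pin p a b).prod r) ∘ₗ (LinearMap.ker (rigMap p T)).subtype
  have hg : Function.Surjective g := by
    rintro ⟨z, y⟩
    obtain ⟨c, t, hct⟩ := exists_triv p a b hab z
    refine ⟨⟨fun v => if h : v ∈ S then c • rot90 (p v) + t else y ⟨v, h⟩, ?_⟩, ?_⟩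
    · rw [LinearMap.mem_ker]
      funext ⟨e, he⟩
      have := hTS e he
      induction e using Sym2.ind with
      | _ u v =>
        have hu := this u (Sym2.mem_mk_left _ _)
        have hv := this v (Sym2.mem_mk_right _ _)
        change dot2 (p u - p v) _ = 0
        simp only [hu, hv, dite_true]
        exact triv_motion p c t u v
    · refine Prod.ext ?_ ?_
      · rw [← hct]
        simp [g, pin, ha, hb]
      · funext ⟨v, hv⟩
        simp [g, r, LinearMap.funLeft_apply, hv]
  have h1 := LinearMap.finrank_le_finrank_of_surjective hg
  have h4 : Module.finrank ℝ ({v // v ∉ S} → ℝ × ℝ) = 2 * Fintype.card {v // v ∉ S} := by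
    rw [Module.finrank_pi_fintype]
    simp [Module.finrank_prod, mul_comm]
  rw [Module.finrank_prod, h4, Module.finrank_prod, Module.finrank_prod,
    Module.finrank_self] at h1
  exact h1

theorem pin_inj (hc : IsCPTLabelling E big) (hs : Stretches G E big p) (a b : V)
    (hab : p a ≠ p b) (q : V → ℝ × ℝ) (hq : IsInfMotion G p q) (h0 : pin p a b q = 0) :
    q = 0 := by
  classical
  let T := G.edgeFinset
  let g := (pin p a b) ∘ₗ (LinearMap.ker (rigMap p T)).subtype
  have hmem : ∀ q, IsInfMotion G p q → q ∈ LinearMap.ker (rigMap p T) := by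
    intro q hq
    rw [LinearMap.mem_ker]
    funext ⟨e, he⟩
    induction e using Sym2.ind with
    | _ u v => exact hq u v (by simpa [T] using he)
  have hg : Function.Surjective g := by
    intro z
    obtain ⟨c, t, hct⟩ := exists_triv p a b hab z
    exact ⟨⟨_, hmem _ (fun u v _ => triv_motion p c t u v)⟩, hct⟩
  have h1 := rank_bound hc hs Set.univ T (Finset.Subset.refl _) (fun _ _ _ _ => trivial)
  have h2 := ker_lower p Set.univ T (fun _ _ _ _ => trivial) a b trivial trivial hab
  have h3 := edge_count hc
  rw [Nat.card_eq_fintype_card, Nat.card_eq_fintype_card, ← SimpleGraph.edgeFinset_card] at h3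
  simp only [Set.mem_univ, true_and] at h1
  have h5 : Module.finrank ℝ (LinearMap.ker (rigMap p T)) = Module.finrank ℝ ((ℝ × ℝ) × ℝ) := by
    rw [Module.finrank_prod, Module.finrank_prod, Module.finrank_self]
    change G.edgeFinset.card + _ ≤ _ at h1
    have h3' : G.edgeFinset.card + 3 = 2 * Fintype.card V
      + (Finset.univ.filter (fun v => ¬ PointedVx big v)).card := by
      convert h3
    omega
  have hinj := (LinearMap.injective_iff_surjective_of_finrank_eq_finrank h5 (f := g)).mpr hg
  have := @hinj ⟨q, hmem q hq⟩ 0 (by rw [map_zero]; exact h0)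
  exact congrArg Subtype.val this

def rmat (G : SimpleGraph V) (a b : V) {R : Type} [CommRing R] (X : V ⊕ V → R) :
    Matrix (G.Dart ⊕ Fin 3) (V ⊕ V) R := fun i j =>
  match i, j with
  | .inl d, .inl v => (X (.inl d.fst) - X (.inl d.snd)) *
      ((if v = d.fst then 1 else 0) - (if v = d.snd then 1 else 0))
  | .inl d, .inr v => (X (.inr d.fst) - X (.inr d.snd)) *
      ((if v = d.fst then 1 else 0) - (if v = d.snd then 1 else 0))
  | .inr 0, .inl v => if v = a then 1 else 0
  | .inr 0, .inr _ => 0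
  | .inr 1, .inl _ => 0
  | .inr 1, .inr v => if v = a then 1 else 0
  | .inr 2, .inl v => -(X (.inr b) - X (.inr a)) *
      ((if v = b then 1 else 0) - (if v = a then 1 else 0))
  | .inr 2, .inr v => (X (.inl b) - X (.inl a)) *
      ((if v = b then 1 else 0) - (if v = a then 1 else 0))

theorem rmat_map (G : SimpleGraph V) (a b : V) {R R' : Type} [CommRing R] [CommRing R']
    (f : R →+* R') (X : V ⊕ V → R) :
    (rmat G a b X).map f = rmat G a b (fun i => f (X i)) := by
  ext i j
  rcases i with d | i
  · rcases j with v | v <;> simp [rmat, apply_ite f]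
  · fin_cases i <;> rcases j with v | v <;> simp [rmat, apply_ite f]

def coords (p : V → ℝ × ℝ) (x : V ⊕ V) : ℝ :=
  Sum.elim (fun v => (p v).1) (fun v => (p v).2) x

theorem rmat_zero_iff (G : SimpleGraph V) [DecidableRel G.Adj] (a b : V) (p q : V → ℝ × ℝ) :
    Matrix.mulVec (rmat G a b (coords p)) (coords q) = 0 ↔
      IsInfMotion G p q ∧ pin p a b q = 0 := by
  have e1 : ∀ d : G.Dart, Matrix.mulVec (rmat G a b (coords p)) (coords q) (.inl d)
      = dot2 (p d.fst - p d.snd) (q d.fst - q d.snd) := by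
    intro d
    simp [Matrix.mulVec, dotProduct, rmat, coords, dot2, mul_assoc, ← Finset.mul_sum, sub_mul]
  have e2 : Matrix.mulVec (rmat G a b (coords p)) (coords q) (.inr 0) = (q a).1 := by
    simp [Matrix.mulVec, dotProduct, rmat, coords]
  have e3 : Matrix.mulVec (rmat G a b (coords p)) (coords q) (.inr 1) = (q a).2 := by
    simp [Matrix.mulVec, dotProduct, rmat, coords]
  have e4 : Matrix.mulVec (rmat G a b (coords p)) (coords q) (.inr 2)
      = dot2 (rot90 (p b - p a)) (q b - q a) := by
    simp [Matrix.mulVec, dotProduct, rmat, coords, dot2, rot90, mul_assoc, ← Finset.mul_sum,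
      sub_mul]
  constructor
  · intro h
    refine ⟨fun u v huv => ?_, Prod.ext (Prod.ext ?_ ?_) ?_⟩
    · exact (e1 ⟨(u, v), huv⟩).symm.trans (congrFun h _)
    · exact e2.symm.trans (congrFun h _)
    · exact e3.symm.trans (congrFun h _)
    · exact e4.symm.trans (congrFun h _)
  · rintro ⟨h1, h2⟩
    funext i
    rcases i with d | i
    · exact (e1 d).trans (h1 _ _ d.adj)
    · fin_cases i
      · exact e2.trans (congrArg (fun z => z.1.1) h2)
      · exact e3.trans (congrArg (fun z => z.1.2) h2)
      · exact e4.trans (congrArg (fun z => z.2) h2)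

theorem pin_iff_det (G : SimpleGraph V) [DecidableRel G.Adj] (a b : V) (p : V → ℝ × ℝ) :
    (∀ q, IsInfMotion G p q → pin p a b q = 0 → q = 0) ↔
      ((rmat G a b (coords p)).transpose * rmat G a b (coords p)).det ≠ 0 := by
  rw [Ne, ← Matrix.exists_mulVec_eq_zero_iff]
  push Not
  have hk : ∀ y, Matrix.mulVec ((rmat G a b (coords p)).transpose * rmat G a b (coords p)) y = 0
      ↔ Matrix.mulVec (rmat G a b (coords p)) y = 0 := by
    intro y
    have := Matrix.ker_mulVecLin_transpose_mul_self (rmat G a b (coords p))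
    exact (SetLike.ext_iff.mp this) y
  constructor
  · intro h y hy hy0
    rw [hk] at hy0
    have hyq : y = coords (fun v => (y (.inl v), y (.inr v))) := by
      funext i; rcases i with v | v <;> rfl
    rw [hyq, rmat_zero_iff] at hy0
    have := h _ hy0.1 hy0.2
    apply hy
    rw [hyq, this]
    funext i; rcases i with v | v <;> rfl
  · intro h q h1 h2
    by_contra hne
    refine h (coords q) ?_ ((hk _).mpr ((rmat_zero_iff G a b p q).mpr ⟨h1, h2⟩))
    intro h0
    apply hne
    funext v
    exact Prod.ext (congrFun h0 (.inl v)) (congrFun h0 (.inr v))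

theorem genRigid_of_pin (G : SimpleGraph V) [DecidableRel G.Adj] (a b : V) (hab : a ≠ b)
    (p : V → ℝ × ℝ)
    (h : ∀ q, IsInfMotion G p q → pin p a b q = 0 → q = 0) : GenRigid G := by
  intro p' hp'
  change AlgebraicIndependent ℚ (coords p') at hp'
  let M := rmat G a b (MvPolynomial.X (R := ℚ) (σ := V ⊕ V))
  let P := (M.transpose * M).det
  have hP : ∀ r : V → ℝ × ℝ, MvPolynomial.aeval (coords r) P =
      ((rmat G a b (coords r)).transpose * rmat G a b (coords r)).det := by
    intro r
    let f : MvPolynomial (V ⊕ V) ℚ →+* ℝ := (MvPolynomial.aeval (R := ℚ) (coords r)).toRingHom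
    change f P = _
    have hM : f.mapMatrix (M.transpose * M)
        = (rmat G a b (coords r)).transpose * rmat G a b (coords r) := by
      have h1 : M.map f = rmat G a b (coords r) := by
        refine (rmat_map G a b f _).trans ?_
        congr 1
        funext i
        exact MvPolynomial.aeval_X _ i
      rw [RingHom.mapMatrix_apply, Matrix.map_mul, Matrix.transpose_map, h1]
    rw [← hM, RingHom.map_det]
  have hP0 : P ≠ 0 := by
    intro h0
    have := hP p
    rw [h0, map_zero] at this
    exact (pin_iff_det G a b p).mp h this.symm
  have h1 : MvPolynomial.aeval (coords p') P ≠ 0 := by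
    intro h0
    exact hP0 (hp' (by rw [h0, map_zero]))
  rw [hP p'] at h1
  refine infRigid_of_pin G p' a b ?_ ((pin_iff_det G a b p').mpr h1)
  intro hpab
  have := hp'.injective (show coords p' (.inl a) = coords p' (.inl b) from
    congrArg Prod.fst hpab)
  exact hab (Sum.inl_injective this)

theorem not_geoPointed (hs : Stretches G E big p) (v : V) (hv : ¬ PointedVx big v) :
    ¬ GeoPointed G p v := by
  rintro ⟨u, hu, h⟩
  obtain ⟨d, hd, hpos⟩ := nonpointed_surround hs v hv (-u.1) (-u.2) (by
    by_contra hh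
    push Not at hh
    exact hu (Prod.ext (by simpa using hh.1) (by simpa using hh.2)))
  subst hd
  have := h d.snd d.adj
  simp only [dot2, Prod.fst_sub, Prod.snd_sub] at this
  simp only [dz, cpx, Prod.fst_sub, Prod.snd_sub] at hpos
  linarith

open Classical in
theorem laman_count (hc : IsCPTLabelling E big) (hs : Stretches G E big p) (S : Set V)
    (hS : 2 ≤ Nat.card S) :
    Nat.card ((G.induce S).edgeSet) + 3 ≤ 2 * Nat.card S
      + (Finset.univ.filter (fun v => v ∈ S ∧ ¬ PointedVx big v)).card := by
  rw [Nat.card_eq_fintype_card] at hS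
  obtain ⟨⟨a, ha⟩, ⟨b, hb⟩, hab⟩ := Fintype.one_lt_card_iff.mp hS
  have hab' : p a ≠ p b := fun h => hab (Subtype.ext (hs.1.1 h))
  let T := G.edgeFinset.filter (fun e => ∀ v ∈ e, v ∈ S)
  have hT : T ⊆ G.edgeFinset := Finset.filter_subset _ _
  have hTS : ∀ e ∈ T, ∀ v ∈ e, v ∈ S := fun e he => (Finset.mem_filter.mp he).2
  have h1 := rank_bound hc hs S T hT hTS
  have h2 := ker_lower p S T hTS a b ha hb hab'
  have h3 := Fintype.card_subtype_compl (fun v => v ∈ S)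
  have h4 := Fintype.card_subtype_le (fun v => v ∈ S)
  have h5 : Nat.card ((G.induce S).edgeSet) ≤ T.card := by
    rw [← Fintype.card_coe T, ← Nat.card_eq_fintype_card]
    refine Nat.card_le_card_of_injective
      (fun e : (G.induce S).edgeSet => (⟨Sym2.map Subtype.val e.1, ?_⟩ : T)) ?_
    · obtain ⟨e, he⟩ := e
      induction e using Sym2.ind with
      | _ u v =>
        have hadj : G.Adj u.1 v.1 := he
        rw [Finset.mem_filter]
        refine ⟨by simpa using hadj, ?_⟩
        intro x hx
        simp only [Sym2.map_mk, Sym2.mem_iff] at hx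
        rcases hx with rfl | rfl
        · exact u.2
        · exact v.2
    · intro e e' h
      exact Subtype.ext (Sym2.map.injective Subtype.val_injective (congrArg Subtype.val h))
  have h6 : Nat.card S = Fintype.card {v // v ∈ S} := by
    rw [Nat.card_eq_fintype_card]
  rw [h6]
  omega

end PTpart

/-- **Theorem 3.** Let `G` be the graph of a pseudo-triangulation of a planar point set in
general position.  Then (1) `G` is infinitesimally rigid, hence generically rigid, and
(2) every subset of `x` non-pointed plus `y` pointed vertices of `G`, with `x + y ≥ 2`,
spans a subgraph with at most `3x + 2y - 3` edges. -/
theorem pseudoTriangulation_infRigid_and_generalized_laman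
    {V : Type} [Fintype V] [DecidableEq V] (G : SimpleGraph V) [DecidableRel G.Adj]
    (E : PlaneEmb G) (p : V → ℝ × ℝ) (hPT : StretchesToPT G E p) :
    InfRigid G p ∧ GenRigid G ∧
      ∀ S : Set V, 2 ≤ Nat.card S →
        (Nat.card ((G.induce S).edgeSet) : ℤ) ≤
          3 * Nat.card {v ∈ S | ¬ GeoPointed G p v}
            + 2 * Nat.card {v ∈ S | GeoPointed G p v} - 3 := by
  classical
  obtain ⟨big, hc, hs⟩ := hPT
  obtain ⟨d0, -⟩ := Quotient.exists_rep E.outer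
  have hne : d0.fst ≠ d0.snd := d0.adj.ne
  have hpne : p d0.fst ≠ p d0.snd := fun h => hne (hs.1.1 h)
  have hpin := pin_inj hc hs d0.fst d0.snd hpne
  refine ⟨infRigid_of_pin G p _ _ hpne hpin, genRigid_of_pin G _ _ hne p hpin, ?_⟩
  intro S hS
  have h1 := laman_count hc hs S hS
  have h2 : (Finset.univ.filter (fun v => v ∈ S ∧ ¬ PointedVx big v)).card
      ≤ (Finset.univ.filter (fun v => v ∈ S ∧ ¬ GeoPointed G p v)).card := by
    apply Finset.card_le_card
    intro v hv
    simp only [Finset.mem_filter, Finset.mem_univ, true_and] at hv ⊢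
    exact ⟨hv.1, not_geoPointed hs v hv.2⟩
  have h3 : Nat.card {v ∈ S | ¬ GeoPointed G p v}
      = (Finset.univ.filter (fun v => v ∈ S ∧ ¬ GeoPointed G p v)).card := by
    exact (Nat.card_eq_fintype_card (α := {v // v ∈ S ∧ ¬ GeoPointed G p v})).trans (Fintype.card_subtype _)
  have h4 : Nat.card {v ∈ S | GeoPointed G p v}
      = (Finset.univ.filter (fun v => v ∈ S ∧ GeoPointed G p v)).card := by
    exact (Nat.card_eq_fintype_card (α := {v // v ∈ S ∧ GeoPointed G p v})).trans (Fintype.card_subtype _)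
  have h5 : Nat.card S = (Finset.univ.filter (fun v => v ∈ S)).card := by
    exact (Nat.card_eq_fintype_card (α := {v // v ∈ S})).trans (Fintype.card_subtype _)
  have h6 := Finset.card_filter_add_card_filter_not (s := Finset.univ.filter (fun v => v ∈ S))
    (fun v => GeoPointed G p v)
  rw [Finset.filter_filter, Finset.filter_filter] at h6
  rw [h3, h4]
  omega
end

section
/- Every combinatorial pseudo-triangulation in the plane with x non-pointed and y pointed vertices has exactly 3x + 2y − 3 edges. -/
/-- **Lemma 2.** Every combinatorial pseudo-triangulation in the plane with `x` non-pointed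
and `y` pointed vertices has exactly `3x + 2y - 3` edges. -/
theorem cpt_edge_count {V : Type} [Fintype V] [DecidableEq V] (G : SimpleGraph V)
    (E : PlaneEmb G) (big : G.Dart → Prop) (hcpt : IsCPTLabelling E big) :
    (Nat.card G.edgeSet : ℤ) =
      3 * Nat.card {v : V | ¬ PointedVx big v} + 2 * Nat.card {v : V | PointedVx big v} - 3 := by
  classical
  have : Fintype E.Face := Fintype.ofFinite _
  -- number of darts
  have h1 : Fintype.card G.Dart = 2 * Nat.card G.edgeSet := by
    rw [SimpleGraph.dart_card_eq_twice_card_edges, SimpleGraph.edgeFinset_card,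
      Nat.card_eq_fintype_card]
  -- big darts
  have h2 : (Finset.univ.filter (fun d : G.Dart => big d)).card
      = (Finset.univ.filter (fun v : V => PointedVx big v)).card := by
    refine Finset.card_bij (fun d _ => d.fst) ?_ ?_ ?_
    · intro d hd
      simp only [Finset.mem_filter, Finset.mem_univ, true_and] at hd ⊢
      exact ⟨d, hd, rfl⟩
    · intro d hd d' hd' h
      simp only [Finset.mem_filter, Finset.mem_univ, true_and] at hd hd'
      exact hcpt.one_big d d' hd hd' h
    · intro v hv
      simp only [Finset.mem_filter, Finset.mem_univ, true_and] at hv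
      obtain ⟨d, hd, h⟩ := hv
      exact ⟨d, by simpa using hd, h⟩
  -- small darts
  have h3 : (Finset.univ.filter (fun d : G.Dart => ¬ big d)).card
      = 3 * (Fintype.card E.Face - 1) := by
    rw [Finset.card_eq_sum_card_fiberwise (f := E.angleFace) (t := Finset.univ.erase E.outer)]
    · rw [Finset.sum_const_nat (m := 3), Finset.card_erase_of_mem (Finset.mem_univ _),
        Finset.card_univ, mul_comm]
      intro F hF
      rw [← hcpt.bounded_small F (Finset.ne_of_mem_erase hF), Nat.card_eq_fintype_card,
        Fintype.card_subtype, Finset.filter_filter]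
      congr 1
      ext d
      simp [and_comm]
    · intro d hd
      have hd' : ¬ big d := by simpa using hd
      simpa using fun h => hd' (hcpt.outer_big d h)
  have h4 := Finset.card_filter_add_card_filter_not (s := (Finset.univ : Finset G.Dart)) (fun d => big d)
  have h5 := Finset.card_filter_add_card_filter_not (s := (Finset.univ : Finset V)) (fun v => PointedVx big v)
  have h6 := E.euler
  have h7 : 0 < Fintype.card E.Face := Fintype.card_pos_iff.mpr ⟨E.outer⟩
  have hx : Nat.card {v : V | ¬ PointedVx big v}
      = (Finset.univ.filter (fun v : V => ¬ PointedVx big v)).card := by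
    rw [Nat.card_eq_fintype_card, Fintype.card_subtype]; rfl
  have hy : Nat.card {v : V | PointedVx big v}
      = (Finset.univ.filter (fun v : V => PointedVx big v)).card := by
    rw [Nat.card_eq_fintype_card, Fintype.card_subtype]; rfl
  have h8 : Nat.card (Quotient (faceSetoid (E.rot * dartSymmPerm G))) = Fintype.card E.Face :=
    Nat.card_eq_fintype_card
  rw [h8, Nat.card_eq_fintype_card (α := V)] at h6
  rw [Finset.card_univ] at h4 h5
  rw [hx, hy]
  omega
end

section
/- A combinatorial pseudo-triangulation G on n vertices has the generalized Laman property (every subset of x non-pointed plus y pointed vertices with x + y ≥ 2 induces a subgraph with at most 3x + 2y − 3 edges) if and only if every subset of x' non-pointed plus y' pointed vertices of G with x' + y' ≤ n − 2 is incident to at least 3x' + 2y' edges. -/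
open Classical in
theorem aux_split {V : Type} [Fintype V] (S : Set V) (P : V → Prop) :
    Nat.card {v ∈ S | P v} + Nat.card {v ∈ Sᶜ | P v} = Nat.card {v | P v} := by
  change Set.ncard {v ∈ S | P v} + Set.ncard {v ∈ Sᶜ | P v} = Set.ncard {v | P v}
  rw [← Set.ncard_union_eq]
  · congr 1
    ext v
    by_cases h : v ∈ S <;> simp [h]
  · rw [Set.disjoint_left]
    rintro v ⟨h, _⟩ ⟨h', _⟩
    exact h' h

theorem aux_induce {V : Type} [Fintype V] (G : SimpleGraph V) (S : Set V) :
    Nat.card (G.induce S).edgeSet + Nat.card {e ∈ G.edgeSet | ∃ v ∈ Sᶜ, v ∈ e} =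
      Nat.card G.edgeSet := by
  change Set.ncard (G.induce S).edgeSet + Set.ncard {e ∈ G.edgeSet | ∃ v ∈ Sᶜ, v ∈ e} =
      Set.ncard G.edgeSet
  have h1 : Set.ncard (G.induce S).edgeSet =
      Set.ncard {e ∈ G.edgeSet | ¬ ∃ v ∈ Sᶜ, v ∈ e} := by
    rw [← Set.ncard_image_of_injective _ (Sym2.map.injective (Subtype.val_injective (p := (· ∈ S))))]
    congr 1
    ext e
    constructor
    · rintro ⟨f, hf, rfl⟩
      induction f with
      | _ a b =>
        refine ⟨by simpa using hf, ?_⟩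
        rintro ⟨v, hv, hv'⟩
        simp only [Sym2.map_mk, Sym2.mem_iff] at hv'
        rcases hv' with rfl | rfl
        · exact hv a.2
        · exact hv b.2
    · rintro ⟨he, hn⟩
      induction e with
      | _ a b =>
        have ha : a ∈ S := by
          by_contra h
          exact hn ⟨a, h, by simp⟩
        have hb : b ∈ S := by
          by_contra h
          exact hn ⟨b, h, by simp⟩
        exact ⟨s(⟨a, ha⟩, ⟨b, hb⟩), by simpa using he, by simp⟩
  rw [h1, add_comm]
  rw [← Set.ncard_union_eq]
  · congr 1
    ext v
    by_cases h : ∃ w ∈ Sᶜ, w ∈ v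
    · exact ⟨fun h' => h'.elim And.left And.left, fun h' => Or.inl ⟨h', h⟩⟩
    · exact ⟨fun h' => h'.elim And.left And.left, fun h' => Or.inr ⟨h', h⟩⟩
  · rw [Set.disjoint_left]
    rintro v ⟨_, h⟩ ⟨_, h'⟩
    exact h' h

open Classical in
theorem aux_card {α : Type} [Fintype α] (P : α → Prop) :
    Nat.card {d | P d} = (Finset.univ.filter P).card := by
  rw [← Set.ncard_coe_finset]
  change Set.ncard _ = _
  congr 1
  ext d
  simp

open Classical in
theorem aux_edges {V : Type} [Fintype V] (G : SimpleGraph V)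
    (E : PlaneEmb G) (big : G.Dart → Prop) (hcpt : IsCPTLabelling E big) :
    (Nat.card G.edgeSet : ℤ) =
      3 * Nat.card {v | ¬ PointedVx big v} + 2 * Nat.card {v | PointedVx big v} - 3 := by
  have hV : Nat.card {v | ¬ PointedVx big v} + Nat.card {v | PointedVx big v} = Nat.card V := by
    have := Set.ncard_add_ncard_compl {v | PointedVx big v}
    rw [add_comm]
    exact this
  have hd : Nat.card G.Dart = 2 * Nat.card G.edgeSet := by
    have := G.dart_card_eq_twice_card_edges
    rw [Nat.card_eq_fintype_card, this, Nat.card_eq_fintype_card, SimpleGraph.edgeFinset_card]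
  have hb : Nat.card {d | big d} = Nat.card {v | PointedVx big v} := by
    refine Nat.card_congr (Equiv.ofBijective
      (fun d => ⟨d.1.fst, ⟨d.1, d.2, rfl⟩⟩) ⟨?_, ?_⟩)
    · rintro ⟨d, hd⟩ ⟨d', hd'⟩ h
      exact Subtype.ext (hcpt.one_big d d' hd hd' (congrArg Subtype.val h))
    · rintro ⟨v, d, hd, rfl⟩
      exact ⟨⟨d, hd⟩, rfl⟩
  have hbs : Nat.card {d | big d} + Nat.card {d | ¬ big d} = Nat.card G.Dart :=
    Set.ncard_add_ncard_compl {d | big d}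
  have : Fintype E.Face := Fintype.ofFinite _
  have hs : Nat.card {d | ¬ big d} = 3 * (Fintype.card E.Face - 1) := by
    have h1 : Nat.card {d | ¬ big d} = (Finset.univ.filter (fun d => ¬ big d)).card := by
      rw [aux_card]; congr
    rw [h1, Finset.card_eq_sum_card_fiberwise (f := E.angleFace) (t := Finset.univ.erase E.outer)]
    · rw [Finset.sum_congr rfl (g := fun _ => 3)]
      · simp [Finset.card_erase_of_mem, mul_comm]
      · intro F hF
        rw [← hcpt.bounded_small F (Finset.ne_of_mem_erase hF), aux_card,
          Finset.filter_filter]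
        congr 1
        ext d
        simp [and_comm]
    · intro d hd
      simp only [Finset.coe_filter, Set.mem_ofPred_eq, Finset.mem_univ, true_and] at hd
      simp only [Finset.coe_erase, Finset.coe_univ, Set.mem_sdiff, Set.mem_univ, true_and,
        Set.mem_singleton_iff]
      exact fun h => hd (hcpt.outer_big d h)
  have hpos : 0 < Fintype.card E.Face := Fintype.card_pos_iff.2 ⟨E.outer⟩
  have he := E.euler
  rw [Nat.card_eq_fintype_card (α := E.Face)] at he
  omega

/-- **Lemma 3.** The generalized Laman property for a combinatorial pseudo-triangulation
(every subset of `x` non-pointed plus `y` pointed vertices, `x + y ≥ 2`, induces at most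
`3x + 2y - 3` edges) is equivalent to: every subset of `x'` non-pointed plus `y'` pointed
vertices with `x' + y' ≤ n - 2` is incident to at least `3x' + 2y'` edges. -/
theorem genLaman_iff_incidence_count
    {V : Type} [Fintype V] [DecidableEq V] (G : SimpleGraph V)
    (E : PlaneEmb G) (big : G.Dart → Prop) (hcpt : IsCPTLabelling E big) :
    GenLaman G big ↔
      ∀ S : Set V, Nat.card S + 2 ≤ Nat.card V →
        3 * Nat.card {v ∈ S | ¬ PointedVx big v} + 2 * Nat.card {v ∈ S | PointedVx big v} ≤
          Nat.card {e ∈ G.edgeSet | ∃ v ∈ S, v ∈ e} := by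
  have he := aux_edges G E big hcpt
  constructor
  · intro h S hS
    have hc : Nat.card S + Nat.card (Sᶜ : Set V) = Nat.card V := Set.ncard_add_ncard_compl S
    have h0 := h Sᶜ (by omega)
    have h1 := aux_split S (PointedVx big)
    have h2 := aux_split S (fun v => ¬ PointedVx big v)
    have h3 := aux_induce G Sᶜ
    rw [compl_compl] at h3
    omega
  · intro h S hS
    have hc : Nat.card S + Nat.card (Sᶜ : Set V) = Nat.card V := Set.ncard_add_ncard_compl S
    have h0 := h Sᶜ (by omega)
    have h1 := aux_split S (PointedVx big)
    have h2 := aux_split S (fun v => ¬ PointedVx big v)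
    have h3 := aux_induce G S
    omega
end

section
/- Let H be a connected subgraph of a combinatorial pseudo-triangulation G such that H contains all edges of G interior to its boundary cycle (i.e., H is the graph of a simply connected subcomplex of G). Let e, x, y and b denote the numbers of edges, non-pointed vertices, pointed vertices, and the length of the boundary cycle of H, respectively. Then the number c1 of corners of H of the first type (vertices whose big angle in G is contained in the outer face of H) equals c1 = e − 3x − 2y + 3 + b. -/
/-- A subcomplex of a plane graph `(G, E)`: a subgraph `H` together with a set of bounded
faces of `G`, such that all edges on the contour of a selected face belong to `H`
("`H` contains all the edges interior to its boundary"). -/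
structure Subcomplex {V : Type} {G : SimpleGraph V} (E : PlaneEmb G) where
  H : G.Subgraph
  faces : Set E.Face
  outer_not_mem : E.outer ∉ faces
  face_closed : ∀ d : G.Dart, E.dartFace d ∈ faces → d.edge ∈ H.edgeSet

theorem aux_fiber {α β : Type} [Finite α] [Finite β] (f : α → β) (A : Set α) (B : Set β) (k : ℕ)
    (hm : ∀ a ∈ A, f a ∈ B) (hk : ∀ b ∈ B, Set.ncard {a | a ∈ A ∧ f a = b} = k) :
    A.ncard = k * B.ncard := by
  classical
  haveI := Fintype.ofFinite α
  haveI := Fintype.ofFinite β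
  have h := Finset.card_eq_sum_card_fiberwise (f := f) (s := A.toFinset) (t := B.toFinset)
    (by intro a ha; simpa using hm a (by simpa using ha))
  rw [Set.ncard_eq_toFinset_card', Set.ncard_eq_toFinset_card', h, mul_comm]
  apply Finset.sum_const_nat
  intro b hb
  rw [← hk b (by simpa using hb), Set.ncard_eq_toFinset_card']
  congr 1
  ext a
  simp

/-- **Lemma 4** (= Lemma 15 of Haas et al.).  Let `H ⊆ G` be a connected subgraph of a CPT
containing all the edges interior to its boundary cycle (the graph of a simply connected
subcomplex of `G`, which we express by connectivity together with the Euler relation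
`#vertices + #faces = #edges + 1`).  If `e`, `x`, `y`, `b` denote its numbers of edges,
non-pointed vertices, pointed vertices, and the length of its boundary cycle (the number of
darts of `H` whose face is not a face of the subcomplex), then the number `c₁` of corners of
the first type (big angles of `G` contained in the outer face of `H`) satisfies
`c₁ = e - 3x - 2y + 3 + b`. -/
theorem corner_count_of_simply_connected_subcomplex
    {V : Type} [Fintype V] [DecidableEq V] (G : SimpleGraph V)
    (E : PlaneEmb G) (big : G.Dart → Prop) (hcpt : IsCPTLabelling E big)
    (C : Subcomplex E) (hconn : C.H.Connected)
    (hsc : Nat.card C.H.verts + Nat.card C.faces = Nat.card C.H.edgeSet + 1) :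
    (Nat.card {v ∈ C.H.verts | ∃ d : G.Dart, big d ∧ d.fst = v ∧ E.angleFace d ∉ C.faces} : ℤ)
      = Nat.card C.H.edgeSet
        - 3 * Nat.card {v ∈ C.H.verts | ¬ PointedVx big v}
        - 2 * Nat.card {v ∈ C.H.verts | PointedVx big v}
        + 3
        + Nat.card {d : G.Dart | d.edge ∈ C.H.edgeSet ∧ E.dartFace d ∉ C.faces} := by
  classical
  have hD : Finite G.Dart := Finite.of_fintype _
  have hF : Finite E.Face := Quotient.finite _
  simp only [Nat.card_coe_set_eq] at hsc ⊢
  -- darts of `H`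
  have h1 : Set.ncard {d : G.Dart | d.edge ∈ C.H.edgeSet} = 2 * C.H.edgeSet.ncard := by
    apply aux_fiber (fun d : G.Dart => d.edge)
    · intro a ha; exact ha
    · intro b hb
      rw [← G.dart_edge_fiber_card b (C.H.edgeSet_subset hb), ← Set.ncard_coe_finset]
      congr 1
      ext d
      simp only [Set.mem_setOf_eq, Finset.coe_filter, Finset.mem_univ, true_and]
      constructor
      · exact fun h => h.2
      · intro h; exact ⟨by rw [h]; exact hb, h⟩
  -- small angles
  have h2 : Set.ncard {d : G.Dart | E.angleFace d ∈ C.faces ∧ ¬ big d} = 3 * C.faces.ncard := by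
    apply aux_fiber E.angleFace
    · intro a ha; exact ha.1
    · intro F hFm
      have hne : F ≠ E.outer := fun h => C.outer_not_mem (h ▸ hFm)
      rw [← hcpt.bounded_small F hne, Nat.card_coe_set_eq]
      congr 1
      ext d
      simp only [Set.mem_setOf_eq]
      constructor
      · exact fun h => ⟨h.2, h.1.2⟩
      · rintro ⟨rfl, h⟩; exact ⟨⟨hFm, h⟩, rfl⟩
  -- all angles
  have h3 : Set.ncard {d : G.Dart | E.angleFace d ∈ C.faces}
      = Set.ncard {d : G.Dart | E.dartFace d ∈ C.faces} := by
    have : {d : G.Dart | E.dartFace d ∈ C.faces}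
        = (dartSymmPerm G) '' {d : G.Dart | E.angleFace d ∈ C.faces} := by
      ext d
      simp only [Set.mem_image, Set.mem_setOf_eq]
      constructor
      · intro h
        refine ⟨d.symm, ?_, SimpleGraph.Dart.symm_symm d⟩
        change E.dartFace d.symm.symm ∈ C.faces
        rwa [SimpleGraph.Dart.symm_symm]
      · rintro ⟨a, ha, rfl⟩
        exact ha
    rw [this, Set.ncard_image_of_injective _ (dartSymmPerm G).injective]
  have h4 : Set.ncard {d : G.Dart | d.edge ∈ C.H.edgeSet}
      = Set.ncard {d : G.Dart | E.dartFace d ∈ C.faces}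
        + Set.ncard {d : G.Dart | d.edge ∈ C.H.edgeSet ∧ E.dartFace d ∉ C.faces} := by
    rw [← Set.ncard_union_eq _ (Set.toFinite _) (Set.toFinite _)]
    · congr 1
      ext d
      have := C.face_closed d
      simp only [Set.mem_setOf_eq, Set.mem_union]
      tauto
    · rw [Set.disjoint_left]
      exact fun d h h' => h'.2 h
  have h5 : Set.ncard {d : G.Dart | E.angleFace d ∈ C.faces}
      = Set.ncard {d : G.Dart | E.angleFace d ∈ C.faces ∧ ¬ big d}
        + Set.ncard {d : G.Dart | E.angleFace d ∈ C.faces ∧ big d} := by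
    rw [← Set.ncard_union_eq _ (Set.toFinite _) (Set.toFinite _)]
    · congr 1
      ext d
      simp only [Set.mem_setOf_eq, Set.mem_union]
      tauto
    · rw [Set.disjoint_left]
      exact fun d h h' => h.2 h'.2
  have hmem : ∀ d : G.Dart, E.angleFace d ∈ C.faces → d.fst ∈ C.H.verts := by
    intro d hd
    have he := C.face_closed d.symm hd
    rw [SimpleGraph.Dart.edge_symm] at he
    exact C.H.mem_verts_of_mem_edge he (Sym2.mem_mk_left _ _)
  have h6 : Set.ncard {v | v ∈ C.H.verts ∧ PointedVx big v}
      = Set.ncard {v | v ∈ C.H.verts ∧ ∃ d : G.Dart, big d ∧ d.fst = v ∧ E.angleFace d ∉ C.faces}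
        + Set.ncard {d : G.Dart | E.angleFace d ∈ C.faces ∧ big d} := by
    have hinj : Set.InjOn (fun d : G.Dart => d.fst) {d : G.Dart | E.angleFace d ∈ C.faces ∧ big d} :=
      fun a ha b hb h => hcpt.one_big a b ha.2 hb.2 h
    rw [← Set.ncard_image_of_injOn hinj, ← Set.ncard_union_eq _ (Set.toFinite _) (Set.toFinite _)]
    · congr 1
      ext v
      simp only [Set.mem_setOf_eq, Set.mem_union, Set.mem_image]
      constructor
      · rintro ⟨hv, d, hb, rfl⟩
        by_cases h : E.angleFace d ∈ C.faces
        · exact Or.inr ⟨d, ⟨h, hb⟩, rfl⟩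
        · exact Or.inl ⟨hv, d, hb, rfl, h⟩
      · rintro (⟨hv, d, hb, rfl, h⟩ | ⟨d, ⟨h, hb⟩, rfl⟩)
        · exact ⟨hv, d, hb, rfl⟩
        · exact ⟨hmem d h, d, hb, rfl⟩
    · rw [Set.disjoint_left]
      rintro v ⟨hv, d, hb, rfl, h⟩ ⟨d', ⟨h', hb'⟩, he⟩
      rw [hcpt.one_big d' d hb' hb he] at h'
      exact h h'
  have h7 : C.H.verts.ncard = Set.ncard {v | v ∈ C.H.verts ∧ ¬ PointedVx big v}
      + Set.ncard {v | v ∈ C.H.verts ∧ PointedVx big v} := by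
    rw [← Set.ncard_union_eq _ (Set.toFinite _) (Set.toFinite _)]
    · congr 1
      ext d
      simp only [Set.mem_setOf_eq, Set.mem_union]
      tauto
    · rw [Set.disjoint_left]
      exact fun d h h' => h.2 h'.2
  omega
end
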